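/- arXiv:1509.04167 — 2 statements merged into one kernel-verified Lean document; each statement's English description precedes it below -/
import Mathlib

section
/- Let X be a countable commutative additive monoid, d, n ≥ 1 integers and ℓ ∈ {0,1,…,n}. For j ∈ {1,…,n} and r ∈ {1,…,d}, let p_j, q_{j,r} ∈ [0,1] with Σ_{r=1}^d q_{j,r} = 1 and λ_r := Σ_{j=1}^n p_j q_{j,r} > 0, and let U_r be probability mass functions in ℓ¹(X). Set Q_j = Σ_{r=1}^d q_{j,r} U_r, λ = Σ_{j=1}^n p_j, Q = (1/λ) Σ_{j=1}^n p_j Q_j, R_j = p_j(Q_j − δ₀), F_j = δ₀ + R_j, V_j = F_j * exp(−R_j) − δ₀, F = ∏_{j=1}^n F_j. For k ∈ {0,…,n} set M_k = Σ_{J⊆{1,…,n}, |J|=k} ∏_{j∈J} V_j, H_k = M_k * exp(λ(Q − δ₀)), and set G_ℓ = Σ_{k=0}^ℓ H_k. Set α₁ = Σ_{j=1}^n g(2p_j) p_j² Σ_{r=1}^d q_{j,r} · min{ q_{j,r}/(2^{3/2} λ_r), 2 }. If α₁ < 2^{−3/2}, then ‖F − G_ℓ‖ ≤ ( √((2(ℓ+1))!)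 / (ℓ+1)! ) · 2^{(ℓ+1)/2} · α₁^{ℓ+1} / (1 − 2^{3/2} α₁). -/
open scoped Classical BigOperators

noncomputable section

namespace PaperL1

variable {X : Type*} [AddCommMonoid X]

/-- Convolution of two summable functions on an additive commutative monoid:
`(f ⋆ g) x = Σ_{(y,z) : y + z = x} f y * g z`. -/
def conv (f g : X → ℝ) : X → ℝ :=
  fun x => ∑' p : {p : X × X // p.1 + p.2 = x}, f p.1.1 * g p.1.2

/-- The Dirac delta at a point: the unit of the convolution algebra is `delta 0`. -/
def delta (x₀ : X) : X → ℝ := fun x => if x = x₀ then 1 else 0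

/-- Convolution powers, with `f^{*0} = δ₀`. -/
def convPow (f : X → ℝ) : ℕ → (X → ℝ)
  | 0 => delta 0
  | n + 1 => conv f (convPow f n)

/-- The exponential in the convolution algebra: `exp f = Σ_m f^{*m}/m!`. -/
def convExp (f : X → ℝ) : X → ℝ :=
  fun x => ∑' m : ℕ, ((m.factorial : ℝ))⁻¹ * convPow f m x

/-- Convolution product over a finite (linearly ordered) index set; the empty
product is `δ₀`. -/
def convProd {ι : Type*} [LinearOrder ι] (s : Finset ι) (f : ι → X → ℝ) : X → ℝ :=
  (s.sort (· ≤ ·)).foldr (fun i acc => conv (f i) acc) (delta 0)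

/-- The ℓ¹ norm: `‖f‖ = Σ_x |f x|`. -/
def l1norm (f : X → ℝ) : ℝ := ∑' x, |f x|

/-- A probability mass function: nonnegative values summing to `1`. -/
def IsPmf (f : X → ℝ) : Prop := (∀ x, 0 ≤ f x) ∧ HasSum f 1

/-- The function `g(x) = 2 Σ_{m=2}^∞ (m-1) x^{m-2} / m!`. -/
def gfun (x : ℝ) : ℝ := ∑' m : ℕ, 2 * (m + 1) * x ^ m / ((m + 2).factorial : ℝ)

end PaperL1

open PaperL1

namespace PaperL1

section Algebra

variable {X : Type*} [AddCommMonoid X]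

/-- The pairing formula for a convolution. -/
lemma conv_pair {f g φ : X → ℝ} {C : ℝ} (hf : Summable f) (hg : Summable g)
    (hφ : ∀ x, |φ x| ≤ C) :
    Summable (fun p : X × X => f p.1 * g p.2 * φ (p.1 + p.2)) ∧
    HasSum (fun x => conv f g x * φ x) (∑' p : X × X, f p.1 * g p.2 * φ (p.1 + p.2)) := by
  have h1 : Summable (fun p : X × X => f p.1 * g p.2) :=
    summable_mul_of_summable_norm hf.norm hg.norm
  have h2 : Summable (fun p : X × X => f p.1 * g p.2 * φ (p.1 + p.2)) := by
    refine Summable.of_norm_bounded (g := fun p : X × X => ‖f p.1 * g p.2‖ * C)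
      (h1.norm.mul_right C) ?_
    intro p
    rw [norm_mul]
    exact mul_le_mul_of_nonneg_left (hφ _) (norm_nonneg _)
  refine ⟨h2, ?_⟩
  let e := Equiv.sigmaFiberEquiv (fun p : X × X => p.1 + p.2)
  have h3 : HasSum ((fun p : X × X => f p.1 * g p.2 * φ (p.1 + p.2)) ∘ e)
      (∑' p : X × X, f p.1 * g p.2 * φ (p.1 + p.2)) := e.hasSum_iff.mpr h2.hasSum
  have h4 : Summable ((fun p : X × X => f p.1 * g p.2) ∘ e) := e.summable_iff.mpr h1
  refine h3.sigma (g := fun x => conv f g x * φ x) ?_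
  intro x
  have h5 : Summable (fun p : {p : X × X // p.1 + p.2 = x} => f p.1.1 * g p.1.2) :=
    h4.sigma_factor x
  have h6 := h5.hasSum.mul_right (φ x)
  have h7 : (fun c : {p : X × X // p.1 + p.2 = x} =>
      ((fun p : X × X => f p.1 * g p.2 * φ (p.1 + p.2)) ∘ e) ⟨x, c⟩) =
      fun c => f c.1.1 * g c.1.2 * φ x := by
    funext c
    simp [e, c.2]
  rw [h7]
  exact h6

lemma conv_summable {f g : X → ℝ} (hf : Summable f) (hg : Summable g) :
    Summable (conv f g) := by
  have := (conv_pair (φ := fun _ => 1) (C := 1) hf hg (by simp)).2.summable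
  simpa using this

lemma conv_apply {f g : X → ℝ} (hf : Summable f) (hg : Summable g) (x : X) :
    conv f g x = ∑' p : X × X, f p.1 * g p.2 * (if p.1 + p.2 = x then 1 else 0) := by
  have := (conv_pair (φ := fun y => if y = x then 1 else 0) (C := 1) hf hg
    (by intro y; split_ifs <;> simp)).2.tsum_eq
  rw [← this]
  simp

lemma conv_comm' (f g : X → ℝ) : conv f g = conv g f := by
  funext x
  unfold conv
  let e : {p : X × X // p.1 + p.2 = x} ≃ {p : X × X // p.1 + p.2 = x} :=
    { toFun := fun p => ⟨(p.1.2, p.1.1), by rw [add_comm]; exact p.2⟩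
      invFun := fun p => ⟨(p.1.2, p.1.1), by rw [add_comm]; exact p.2⟩
      left_inv := fun p => rfl
      right_inv := fun p => rfl }
  rw [← e.tsum_eq]
  exact tsum_congr fun p => mul_comm _ _

lemma conv_norm_le {f g : X → ℝ} (hf : Summable f) (hg : Summable g) :
    ∑' x, |conv f g x| ≤ (∑' x, |f x|) * ∑' x, |g x| := by
  let φ : X → ℝ := fun x => SignType.sign (conv f g x)
  have hφ : ∀ x, |φ x| ≤ 1 := by
    intro x
    rcases lt_trichotomy (conv f g x) 0 with h | h | h <;> simp [φ, h]
  have h := conv_pair hf hg hφ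
  have h1 : ∑' x, |conv f g x| = ∑' x, conv f g x * φ x := by
    refine tsum_congr fun x => ?_
    simp [φ]
  have h0 : Summable (fun p : X × X => |f p.1| * |g p.2|) :=
    summable_mul_of_summable_norm hf.norm.norm hg.norm.norm
  rw [h1, h.2.tsum_eq, hf.abs.tsum_mul_tsum hg.abs h0]
  refine h.1.tsum_le_tsum ?_ h0
  intro p
  calc f p.1 * g p.2 * φ (p.1 + p.2) ≤ |f p.1 * g p.2 * φ (p.1 + p.2)| := le_abs_self _
    _ = |f p.1| * |g p.2| * |φ (p.1 + p.2)| := by rw [abs_mul, abs_mul]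
    _ ≤ |f p.1| * |g p.2| * 1 := by gcongr; exact hφ _
    _ = _ := mul_one _

lemma conv_three {f g h φ : X → ℝ} {C : ℝ} (hf : Summable f) (hg : Summable g) (hh : Summable h)
    (hφ : ∀ x, |φ x| ≤ C) :
    Summable (fun t : (X × X) × X => f t.1.1 * g t.1.2 * h t.2 * φ (t.1.1 + t.1.2 + t.2)) ∧
    ∑' p : X × X, conv f g p.1 * h p.2 * φ (p.1 + p.2) =
      ∑' t : (X × X) × X, f t.1.1 * g t.1.2 * h t.2 * φ (t.1.1 + t.1.2 + t.2) := by
  have h1 : Summable (fun p : X × X => f p.1 * g p.2) :=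
    summable_mul_of_summable_norm hf.norm hg.norm
  have h2 : Summable (fun t : (X × X) × X => (f t.1.1 * g t.1.2) * h t.2) :=
    summable_mul_of_summable_norm (f := fun p : X × X => f p.1 * g p.2) h1.norm hh.norm
  have h3 : Summable
      (fun t : (X × X) × X => f t.1.1 * g t.1.2 * h t.2 * φ (t.1.1 + t.1.2 + t.2)) := by
    refine Summable.of_norm_bounded (g := fun t : (X × X) × X => ‖f t.1.1 * g t.1.2 * h t.2‖ * C)
      (h2.norm.mul_right C) ?_
    intro p
    rw [norm_mul]
    exact mul_le_mul_of_nonneg_left (hφ _) (norm_nonneg _)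
  refine ⟨h3, ?_⟩
  have hfg := conv_summable hf hg
  have hs := (conv_pair hfg hh hφ).1
  rw [← (Equiv.prodComm X X).tsum_eq, ← (Equiv.prodComm X (X × X)).tsum_eq]
  have hs' := (Equiv.prodComm X X).summable_iff.mpr hs
  have h3' := (Equiv.prodComm X (X × X)).summable_iff.mpr h3
  have e1 := hs'.tsum_prod
  have e2 := h3'.tsum_prod
  simp only [Function.comp_def, Equiv.prodComm_apply, Prod.fst_swap, Prod.snd_swap] at e1 e2 ⊢
  rw [e1, e2]
  refine tsum_congr fun z => ?_
  have := (conv_pair (φ := fun x => h z * φ (x + z)) (C := |h z| * C) hf hg (by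
    intro x; rw [abs_mul]; exact mul_le_mul_of_nonneg_left (hφ _) (abs_nonneg _))).2.tsum_eq
  simp only [← mul_assoc] at this
  exact this

lemma conv_assoc' {f g h : X → ℝ} (hf : Summable f) (hg : Summable g) (hh : Summable h) :
    conv (conv f g) h = conv f (conv g h) := by
  funext x
  rw [conv_comm' f (conv g h), conv_apply (conv_summable hf hg) hh,
    conv_apply (conv_summable hg hh) hf]
  have hφ : ∀ y, |(fun y => if y = x then (1:ℝ) else 0) y| ≤ 1 := by
    intro y; dsimp only; split_ifs <;> simp
  have h1 := (conv_three hf hg hh hφ).2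
  have h2 := (conv_three hg hh hf hφ).2
  rw [h1, h2]
  let e : (X × X) × X ≃ (X × X) × X :=
    { toFun := fun t => ((t.2, t.1.1), t.1.2)
      invFun := fun t => ((t.1.2, t.2), t.1.1)
      left_inv := fun t => rfl
      right_inv := fun t => rfl }
  rw [← e.tsum_eq]
  refine tsum_congr fun t => ?_
  have : t.2 + t.1.1 + t.1.2 = t.1.1 + t.1.2 + t.2 := by abel
  simp only [e, Equiv.coe_fn_mk, this]
  ring

lemma delta_summable {X : Type*} (x₀ : X) : Summable (delta x₀ : X → ℝ) :=
  (hasSum_ite_eq x₀ (1:ℝ)).summable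

lemma delta_conv {f : X → ℝ} (hf : Summable f) : conv (delta 0) f = f := by
  funext x
  rw [conv_apply (delta_summable 0) hf]
  have hφ : ∀ y, |(fun y => if y = x then (1:ℝ) else 0) y| ≤ 1 := by
    intro y; dsimp only; split_ifs <;> simp
  have hs := (conv_pair (delta_summable (0:X)) hf hφ).1
  rw [hs.tsum_prod, tsum_eq_single (0:X)]
  · simp [delta]
  · intro b hb; simp [delta, hb]

lemma conv_add {f g h : X → ℝ} (hf : Summable f) (hg : Summable g) (hh : Summable h) :
    conv f (g + h) = conv f g + conv f h := by
  funext x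
  have s1 := (summable_mul_of_summable_norm hf.norm hg.norm).subtype {p : X × X | p.1 + p.2 = x}
  have s2 := (summable_mul_of_summable_norm hf.norm hh.norm).subtype {p : X × X | p.1 + p.2 = x}
  simp only [conv, Pi.add_apply, mul_add]
  exact s1.tsum_add s2

lemma conv_smul (c : ℝ) (f g : X → ℝ) : conv f (c • g) = c • conv f g := by
  funext x
  simp only [conv, Pi.smul_apply, smul_eq_mul, ← tsum_mul_left]
  exact tsum_congr fun p => by ring

end Algebra

/-- The Banach space of summable functions. -/
def L1 (X : Type*) : Type _ := lp (fun _ : X => ℝ) 1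

namespace L1

variable {X : Type*}

instance : NormedAddCommGroup (L1 X) := inferInstanceAs (NormedAddCommGroup (lp (fun _ : X => ℝ) 1))
instance : NormedSpace ℝ (L1 X) := inferInstanceAs (NormedSpace ℝ (lp (fun _ : X => ℝ) 1))
instance : CompleteSpace (L1 X) := inferInstanceAs (CompleteSpace (lp (fun _ : X => ℝ) 1))

/-- Underlying function. -/
def fn (f : L1 X) : X → ℝ := (show lp (fun _ : X => ℝ) 1 from f).1

/-- Build an element from a summable function. -/
def mk (f : X → ℝ) (hf : Summable f) : L1 X :=
  (⟨f, memℓp_gen (by simpa using hf.abs)⟩ : lp (fun _ : X => ℝ) 1)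

@[simp] lemma fn_mk (f : X → ℝ) (hf : Summable f) : (mk f hf).fn = f := rfl

lemma summable (f : L1 X) : Summable f.fn := by
  have : Memℓp f.fn 1 := (show lp (fun _ : X => ℝ) 1 from f).2
  exact this.summable_of_one

lemma ext' {f g : L1 X} (h : f.fn = g.fn) : f = g := Subtype.ext h

lemma norm_def (f : L1 X) : ‖f‖ = l1norm f.fn := by
  have := lp.norm_eq_tsum_rpow (p := 1) (by simp) (show lp (fun _ : X => ℝ) 1 from f)
  simp only [ENNReal.toReal_one, Real.rpow_one, div_one] at this
  exact this

@[simp] lemma fn_add (f g : L1 X) : (f + g).fn = f.fn + g.fn := rfl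
@[simp] lemma fn_sub (f g : L1 X) : (f - g).fn = f.fn - g.fn := rfl
@[simp] lemma fn_neg (f : L1 X) : (-f).fn = -f.fn := rfl
@[simp] lemma fn_zero : (0 : L1 X).fn = 0 := rfl
@[simp] lemma fn_smul (c : ℝ) (f : L1 X) : (c • f).fn = c • f.fn := rfl

lemma fn_sum {ι : Type*} (s : Finset ι) (f : ι → L1 X) :
    (∑ i ∈ s, f i).fn = ∑ i ∈ s, (f i).fn := by
  induction s using Finset.induction_on with
  | empty => simp
  | insert a s ha ih => simp [Finset.sum_insert ha, ih]

/-- evaluation as a continuous linear map. -/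
def ev (x : X) : L1 X →L[ℝ] ℝ := lp.evalCLM ℝ (fun _ : X => ℝ) 1 x

@[simp] lemma ev_apply (x : X) (f : L1 X) : ev x f = f.fn x := rfl

variable [AddCommMonoid X]

instance : Mul (L1 X) := ⟨fun f g => mk (conv f.fn g.fn) (conv_summable f.summable g.summable)⟩
instance : One (L1 X) := ⟨mk (delta 0) (delta_summable 0)⟩

@[simp] lemma fn_mul (f g : L1 X) : (f * g).fn = conv f.fn g.fn := rfl
@[simp] lemma fn_one : (1 : L1 X).fn = delta 0 := rfl

lemma mul_comm'' (f g : L1 X) : f * g = g * f := ext' (conv_comm' _ _)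
lemma one_mul'' (f : L1 X) : 1 * f = f := ext' (delta_conv f.summable)
lemma mul_add'' (f g h : L1 X) : f * (g + h) = f * g + f * h :=
  ext' (conv_add f.summable g.summable h.summable)

instance : NormedCommRing (L1 X) :=
  { (inferInstance : NormedAddCommGroup (L1 X)) with
    mul_assoc := fun f g h => ext' (conv_assoc' f.summable g.summable h.summable)
    mul_comm := mul_comm''
    one_mul := one_mul''
    mul_one := fun f => by rw [mul_comm'', one_mul'']
    left_distrib := mul_add''
    right_distrib := fun f g h => by
      rw [mul_comm'' (f + g), mul_add'', mul_comm'' h, mul_comm'' h]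
    zero_mul := fun f => by
      have := mul_add'' f 0 0
      rw [add_zero] at this
      rw [mul_comm'']
      simpa using this
    mul_zero := fun f => by
      have := mul_add'' f 0 0
      rw [add_zero] at this
      simpa using this
    norm_mul_le := fun f g => by
      show ‖f * g‖ ≤ ‖f‖ * ‖g‖
      rw [norm_def, norm_def, norm_def]
      exact conv_norm_le f.summable g.summable }

instance : NormedAlgebra ℝ (L1 X) :=
  { Algebra.ofModule (R := ℝ) (A := L1 X)
      (fun c f g => by rw [mul_comm, mul_comm f g]; exact ext' (conv_smul c _ _))
      (fun c f g => ext' (conv_smul c _ _)) with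
    norm_smul_le := fun c f => norm_smul_le c f }

lemma fn_pow (f : L1 X) (m : ℕ) : (f ^ m).fn = convPow f.fn m := by
  induction m with
  | zero => rw [pow_zero]; rfl
  | succ m ih => rw [pow_succ', fn_mul, ih]; rfl

lemma fn_exp (f : L1 X) : (NormedSpace.exp f).fn = convExp f.fn := by
  funext x
  have h := (NormedSpace.exp_series_hasSum_exp' (𝕂 := ℝ) f)
  have h2 := (ev x).hasSum h
  simp only [ev_apply, fn_smul, fn_pow, Pi.smul_apply, smul_eq_mul] at h2
  exact h2.tsum_eq.symm

lemma fn_prod {ι : Type*} [LinearOrder ι] (s : Finset ι) (f : ι → L1 X) :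
    (∏ i ∈ s, f i).fn = convProd s (fun i => (f i).fn) := by
  have h1 : ∏ i ∈ s, f i = ((s.sort (· ≤ ·)).map f).prod := by
    have h2 := Finset.sort_eq s (· ≤ ·)
    have h3 : ∏ i ∈ s, f i = (Multiset.map f (s.sort (· ≤ ·) : Multiset ι)).prod := by
      rw [h2]; rfl
    rw [h3, Multiset.map_coe, Multiset.prod_coe]
  rw [h1, convProd]
  generalize s.sort (· ≤ ·) = l
  induction l with
  | nil => rfl
  | cons a l ih => simp only [List.map_cons, List.prod_cons, fn_mul, ih, List.foldr_cons]

lemma norm_one' : ‖(1 : L1 X)‖ = 1 := by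
  rw [norm_def, fn_one, l1norm, tsum_eq_single (0:X)]
  · simp [delta]
  · intro b hb; simp [delta, hb]

end L1

end PaperL1
namespace PaperL1

section Pois

lemma hasSum_pi_prod {A : Type*} [NormedCommRing A] [CompleteSpace A] :
    ∀ (d : ℕ) (u : Fin d → ℕ → A) (_ : ∀ r, Summable fun k => ‖u r k‖),
      (Summable fun x : Fin d → ℕ => ‖∏ r, u r (x r)‖) ∧
      HasSum (fun x : Fin d → ℕ => ∏ r, u r (x r)) (∏ r, ∑' k, u r k) := by
  intro d
  induction d with
  | zero =>
    intro u _
    refine ⟨(hasSum_fintype _).summable, ?_⟩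
    simp
  | succ d ih =>
    intro u hu
    obtain ⟨h1, h2⟩ := ih (fun r => u r.succ) (fun r => hu r.succ)
    let e : ℕ × (Fin d → ℕ) ≃ (Fin (d + 1) → ℕ) := Fin.consEquiv (fun _ => ℕ)
    have hn := (hu 0).mul_norm h1
    have hs := (summable_mul_of_summable_norm (hu 0) h1)
    have hm := (hu 0).of_norm.hasSum.mul h2 hs
    have key : (fun x : Fin (d+1) → ℕ => ∏ r, u r (x r)) ∘ e =
        fun p => u 0 p.1 * ∏ r, u (Fin.succ r) (p.2 r) := by
      funext p
      simp [e, Fin.consEquiv, Fin.prod_univ_succ]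
    refine ⟨?_, ?_⟩
    · rw [← e.summable_iff]
      have : (fun x : Fin (d+1) → ℕ => ‖∏ r, u r (x r)‖) ∘ e =
        fun p => ‖u 0 p.1 * ∏ r, u (Fin.succ r) (p.2 r)‖ := by
        funext p
        exact congrArg norm (congrFun key p)
      rw [this]; exact hn
    · rw [← e.hasSum_iff, key, Fin.prod_univ_succ]
      exact hm

variable {d : ℕ}

/-- product Poisson weights. -/
def pw (lam : Fin d → ℝ) (x : Fin d → ℕ) : ℝ :=
  ∏ r, (Real.exp (-lam r) * (lam r ^ x r / ((x r).factorial : ℝ)))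

lemma pw_nonneg {lam : Fin d → ℝ} (hl : ∀ r, 0 < lam r) (x) : 0 ≤ pw lam x :=
  Finset.prod_nonneg fun r _ => by have := hl r; positivity

/-- exponential growth class. -/
def Good (f : (Fin d → ℕ) → ℝ) : Prop :=
  ∃ C K : ℝ, 0 ≤ C ∧ 1 ≤ K ∧ ∀ x, |f x| ≤ C * K ^ (∑ r, x r)

lemma Good.const (c : ℝ) : Good (fun _ : Fin d → ℕ => c) :=
  ⟨|c|, 1, abs_nonneg c, le_rfl, fun x => by simp⟩

lemma Good.add {f g : (Fin d → ℕ) → ℝ} (hf : Good f) (hg : Good g) :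
    Good (fun x => f x + g x) := by
  obtain ⟨C, K, hC, hK, h⟩ := hf
  obtain ⟨C', K', hC', hK', h'⟩ := hg
  refine ⟨C + C', max K K', by positivity, le_max_of_le_left hK, fun x => ?_⟩
  calc |f x + g x| ≤ |f x| + |g x| := abs_add_le _ _
    _ ≤ C * K ^ (∑ r, x r) + C' * K' ^ (∑ r, x r) := add_le_add (h x) (h' x)
    _ ≤ C * (max K K') ^ (∑ r, x r) + C' * (max K K') ^ (∑ r, x r) := by
      gcongr
      · exact le_max_left _ _
      · exact le_max_right _ _
    _ = _ := by ring

lemma Good.mul {f g : (Fin d → ℕ) → ℝ} (hf : Good f) (hg : Good g) :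
    Good (fun x => f x * g x) := by
  obtain ⟨C, K, hC, hK, h⟩ := hf
  obtain ⟨C', K', hC', hK', h'⟩ := hg
  refine ⟨C * C', K * K', by positivity, one_le_mul_of_one_le_of_one_le hK hK', fun x => ?_⟩
  rw [abs_mul, mul_pow]
  calc |f x| * |g x| ≤ (C * K ^ (∑ r, x r)) * (C' * K' ^ (∑ r, x r)) :=
        mul_le_mul (h x) (h' x) (abs_nonneg _) (by positivity)
    _ = _ := by ring

lemma Good.sub {f g : (Fin d → ℕ) → ℝ} (hf : Good f) (hg : Good g) :
    Good (fun x => f x - g x) := by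
  have := hf.add ((Good.const (-1)).mul hg)
  simpa [sub_eq_add_neg] using this

lemma Good.abs {f : (Fin d → ℕ) → ℝ} (hf : Good f) : Good (fun x => |f x|) := by
  obtain ⟨C, K, hC, hK, h⟩ := hf
  exact ⟨C, K, hC, hK, by simpa using h⟩

lemma Good.sum {ι : Type*} (s : Finset ι) {f : ι → (Fin d → ℕ) → ℝ} (hf : ∀ i ∈ s, Good (f i)) :
    Good (fun x => ∑ i ∈ s, f i x) := by
  induction s using Finset.induction_on with
  | empty => simpa using Good.const 0
  | insert a s ha ih =>
    simp only [Finset.sum_insert ha]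
    exact (hf a (by simp)).add (ih fun i hi => hf i (by simp [hi]))

lemma Good.coord (r : Fin d) : Good (fun x : Fin d → ℕ => (x r : ℝ)) := by
  refine ⟨1, 2, by norm_num, by norm_num, fun x => ?_⟩
  rw [one_mul, Nat.abs_cast]
  have h1 : x r ≤ ∑ r, x r := Finset.single_le_sum (fun _ _ => Nat.zero_le _) (Finset.mem_univ r)
  have h2 : x r ≤ 2 ^ (∑ r, x r) := h1.trans (Nat.lt_two_pow_self).le
  exact_mod_cast h2

lemma Good.up {f : (Fin d → ℕ) → ℝ} (hf : Good f) (r : Fin d) :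
    Good (fun x => f (x + Pi.single r 1)) := by
  obtain ⟨C, K, hC, hK, h⟩ := hf
  refine ⟨C * K, K, by positivity, hK, fun x => ?_⟩
  refine (h _).trans (le_of_eq ?_)
  simp [Finset.sum_add_distrib, pow_succ]
  ring

lemma Good.dn {f : (Fin d → ℕ) → ℝ} (hf : Good f) (r : Fin d) :
    Good (fun x => f (x - Pi.single r 1)) := by
  obtain ⟨C, K, hC, hK, h⟩ := hf
  refine ⟨C, K, by positivity, hK, fun x => ?_⟩
  refine (h _).trans ?_
  refine mul_le_mul_of_nonneg_left (pow_le_pow_right₀ hK ?_) hC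
  exact Finset.sum_le_sum fun i _ => Nat.sub_le _ _

lemma Good.summable {lam : Fin d → ℝ} (hl : ∀ r, 0 < lam r) {f : (Fin d → ℕ) → ℝ} (hf : Good f) :
    Summable (fun x => pw lam x * f x) := by
  obtain ⟨C, K, hC, hK, h⟩ := hf
  have h1 : ∀ r, Summable fun k : ℕ =>
      ‖Real.exp (-lam r) * ((lam r * K) ^ k / (k.factorial : ℝ))‖ := fun r =>
    ((Real.summable_pow_div_factorial (lam r * K)).mul_left _).norm
  have h2 := ((hasSum_pi_prod d _ h1).1).mul_left C
  refine Summable.of_norm_bounded h2 fun x => ?_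
  rw [norm_mul, Real.norm_of_nonneg (pw_nonneg hl x), Real.norm_of_nonneg
    (Finset.prod_nonneg fun r _ => by have := hl r; positivity), Real.norm_eq_abs]
  refine (mul_le_mul_of_nonneg_left (h x) (pw_nonneg hl x)).trans (le_of_eq ?_)
  rw [pw, ← Finset.prod_pow_eq_pow_sum, mul_left_comm, ← Finset.prod_mul_distrib]
  congr 1
  refine Finset.prod_congr rfl fun r _ => ?_
  rw [mul_pow]; ring

/-- expectation functional. -/
def Ex (lam : Fin d → ℝ) (f : (Fin d → ℕ) → ℝ) : ℝ := ∑' x, pw lam x * f x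

lemma Ex_add {lam : Fin d → ℝ} (hl : ∀ r, 0 < lam r) {f g : (Fin d → ℕ) → ℝ}
    (hf : Good f) (hg : Good g) : Ex lam (fun x => f x + g x) = Ex lam f + Ex lam g := by
  simp only [Ex, mul_add]
  exact (hf.summable hl).tsum_add (hg.summable hl)

lemma Ex_smul {lam : Fin d → ℝ} (c : ℝ) (f : (Fin d → ℕ) → ℝ) :
    Ex lam (fun x => c * f x) = c * Ex lam f := by
  simp only [Ex, ← tsum_mul_left]
  exact tsum_congr fun x => by ring

lemma Ex_sub {lam : Fin d → ℝ} (hl : ∀ r, 0 < lam r) {f g : (Fin d → ℕ) → ℝ}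
    (hf : Good f) (hg : Good g) : Ex lam (fun x => f x - g x) = Ex lam f - Ex lam g := by
  simp only [Ex, mul_sub]
  exact (hf.summable hl).tsum_sub (hg.summable hl)

lemma Ex_sum {lam : Fin d → ℝ} (hl : ∀ r, 0 < lam r) {ι : Type*} (s : Finset ι)
    {f : ι → (Fin d → ℕ) → ℝ}
    (hf : ∀ i, Good (f i)) : Ex lam (fun x => ∑ i ∈ s, f i x) = ∑ i ∈ s, Ex lam (f i) := by
  simp only [Ex, Finset.mul_sum]
  exact Summable.tsum_finsetSum fun i _ => (hf i).summable hl

lemma Ex_mono {lam : Fin d → ℝ} (hl : ∀ r, 0 < lam r) {f g : (Fin d → ℕ) → ℝ}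
    (hf : Good f) (hg : Good g) (h : ∀ x, f x ≤ g x) : Ex lam f ≤ Ex lam g :=
  (hf.summable hl).tsum_le_tsum (fun x => mul_le_mul_of_nonneg_left (h x) (pw_nonneg hl x))
    (hg.summable hl)

lemma Ex_nonneg {lam : Fin d → ℝ} (hl : ∀ r, 0 < lam r) {f : (Fin d → ℕ) → ℝ}
    (h : ∀ x, 0 ≤ f x) : 0 ≤ Ex lam f :=
  tsum_nonneg fun x => mul_nonneg (pw_nonneg hl x) (h x)

lemma Ex_one {lam : Fin d → ℝ} : Ex lam (fun _ => 1) = 1 := by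
  have h1 : ∀ r, Summable fun k : ℕ =>
      ‖Real.exp (-lam r) * ((lam r) ^ k / (k.factorial : ℝ))‖ := fun r =>
    ((Real.summable_pow_div_factorial (lam r)).mul_left _).norm
  have h2 := ((hasSum_pi_prod d _ h1).2).tsum_eq
  simp only [Ex, mul_one, pw]
  rw [h2]
  refine Finset.prod_eq_one fun r _ => ?_
  rw [tsum_mul_left]
  have h3 : Real.exp (lam r) = ∑' k : ℕ, lam r ^ k / (k.factorial : ℝ) := by
    rw [Real.exp_eq_exp_ℝ, NormedSpace.exp_eq_tsum_div]
  rw [← h3, ← Real.exp_add]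
  simp

lemma Ex_abs_sq {lam : Fin d → ℝ} (hl : ∀ r, 0 < lam r) {f : (Fin d → ℕ) → ℝ}
    (hf : Good f) : Ex lam (fun x => |f x|) ^ 2 ≤ Ex lam (fun x => f x ^ 2) := by
  set m := Ex lam (fun x => |f x|) with hm
  have h0 : 0 ≤ Ex lam (fun x => (|f x| - m) ^ 2) := Ex_nonneg hl fun x => sq_nonneg _
  have h1 : (fun x => (|f x| - m) ^ 2) = fun x => (f x * f x - (2 * m) * |f x|) + m ^ 2 * 1 := by
    funext x
    rw [← abs_mul_abs_self (f x)]; ring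
  rw [h1, Ex_add hl ((hf.mul hf).sub ((Good.const _).mul hf.abs)) ((Good.const _).mul (Good.const _)),
    Ex_sub hl (hf.mul hf) ((Good.const _).mul hf.abs), Ex_smul, Ex_smul, Ex_one, ← hm] at h0
  have h2 : (fun x => f x ^ 2) = fun x => f x * f x := by funext x; ring
  rw [h2]
  linarith

lemma pw_up {lam : Fin d → ℝ} (hl : ∀ r, 0 < lam r) (x : Fin d → ℕ) (r : Fin d) :
    pw lam (x + Pi.single r 1) * (((x + Pi.single r 1 : Fin d → ℕ) r : ℝ) / lam r) = pw lam x := by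
  unfold pw
  rw [← Finset.mul_prod_erase _ _ (Finset.mem_univ r), ← Finset.mul_prod_erase _ _ (Finset.mem_univ r)]
  have h1 : ∏ s ∈ Finset.univ.erase r, (Real.exp (-lam s) *
      (lam s ^ (x + Pi.single r 1 : Fin d → ℕ) s / (((x + Pi.single r 1 : Fin d → ℕ) s).factorial : ℝ))) =
      ∏ s ∈ Finset.univ.erase r, (Real.exp (-lam s) * (lam s ^ x s / ((x s).factorial : ℝ))) := by
    refine Finset.prod_congr rfl fun s hs => ?_
    simp [Pi.single_eq_of_ne (Finset.ne_of_mem_erase hs)]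
  rw [h1]
  have h2 : (x + Pi.single r 1 : Fin d → ℕ) r = x r + 1 := by simp
  rw [h2, Nat.factorial_succ, pow_succ]
  have := (hl r).ne'
  have h3 : ((x r).factorial : ℝ) ≠ 0 := by positivity
  have h4 : ((x r : ℝ) + 1) ≠ 0 := by positivity
  push_cast
  field_simp

lemma shift_sum {lam : Fin d → ℝ} (hl : ∀ r, 0 < lam r) {B : Type*} [NormedAddCommGroup B]
    [NormedSpace ℝ B] (f : (Fin d → ℕ) → ℝ) (W : (Fin d → ℕ) → B) (r : Fin d) :
    ∑' x, (pw lam x * f x) • W (x + Pi.single r 1) =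
      ∑' x, (pw lam x * ((x r : ℝ) / lam r * f (x - Pi.single r 1))) • W x := by
  have hinj : Function.Injective (fun x : Fin d → ℕ => x + Pi.single r 1) :=
    add_left_injective _
  symm
  refine (hinj.tsum_eq ?_).symm.trans (tsum_congr fun x => ?_)
  · intro x hx
    have : x r ≠ 0 := by
      intro h
      simp [h] at hx
    refine ⟨x - Pi.single r 1, ?_⟩
    refine tsub_add_cancel_of_le ?_
    intro s
    by_cases h : s = r
    · subst h; simp; omega
    · simp [Pi.single_eq_of_ne h]
  · rw [← mul_assoc, pw_up hl, add_tsub_cancel_right]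

/-- creation operator. -/
def Tc (lam : Fin d → ℝ) (b : Fin d → ℝ) (f : (Fin d → ℕ) → ℝ) : (Fin d → ℕ) → ℝ :=
  fun x => ∑ r, b r * ((x r : ℝ) / lam r * f (x - Pi.single r 1) - f x)

/-- annihilation operator. -/
def Da (a : Fin d → ℝ) (f : (Fin d → ℕ) → ℝ) : (Fin d → ℕ) → ℝ :=
  fun x => ∑ r, a r * (f (x + Pi.single r 1) - f x)

/-- weighted inner product. -/
def ip (lam a b : Fin d → ℝ) : ℝ := ∑ r, a r * b r / lam r

lemma Good.Tc {lam b : Fin d → ℝ} {f : (Fin d → ℕ) → ℝ} (hf : Good f) : Good (Tc lam b f) := by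
  refine Good.sum _ fun r _ => (Good.const _).mul (((Good.mul ?_ (hf.dn r)).sub hf))
  simp only [div_eq_mul_inv]
  exact (Good.coord r).mul (Good.const _)

lemma Good.Da {a : Fin d → ℝ} {f : (Fin d → ℕ) → ℝ} (hf : Good f) : Good (Da a f) :=
  Good.sum _ fun r _ => (Good.const _).mul ((hf.up r).sub hf)

lemma adj {lam : Fin d → ℝ} (hl : ∀ r, 0 < lam r) (b : Fin d → ℝ) {f g : (Fin d → ℕ) → ℝ}
    (hf : Good f) (hg : Good g) :
    Ex lam (fun x => Tc lam b f x * g x) = Ex lam (fun x => f x * Da b g x) := by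
  have hc : ∀ r, Good (fun x : Fin d → ℕ => (x r : ℝ) / lam r * f (x - Pi.single r 1)) := by
    intro r
    refine Good.mul ?_ (hf.dn r)
    simp only [div_eq_mul_inv]
    exact (Good.coord r).mul (Good.const _)
  have e1 : (fun x => Tc lam b f x * g x) = fun x => ∑ r, b r *
      ((x r : ℝ) / lam r * f (x - Pi.single r 1) * g x - f x * g x) := by
    funext x
    simp only [Tc, Finset.sum_mul]
    exact Finset.sum_congr rfl fun r _ => by ring
  have e2 : (fun x => f x * Da b g x) = fun x => ∑ r, b r *
      (f x * g (x + Pi.single r 1) - f x * g x) := by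
    funext x
    simp only [Da, Finset.mul_sum]
    exact Finset.sum_congr rfl fun r _ => by ring
  rw [e1, e2, Ex_sum hl _ fun r => (Good.const _).mul (((hc r).mul hg).sub (hf.mul hg)),
    Ex_sum hl _ fun r => (Good.const _).mul ((hf.mul (hg.up r)).sub (hf.mul hg))]
  refine Finset.sum_congr rfl fun r _ => ?_
  rw [Ex_smul, Ex_smul, Ex_sub hl ((hc r).mul hg) (hf.mul hg),
    Ex_sub hl (hf.mul (hg.up r)) (hf.mul hg)]
  congr 2
  have := shift_sum hl f g r
  simp only [smul_eq_mul, mul_assoc] at this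
  simp only [Ex, mul_assoc]
  exact this.symm

lemma Tc_add {lam b : Fin d → ℝ} (c : ℝ) (f g : (Fin d → ℕ) → ℝ) :
    Tc lam b (fun x => c * f x + g x) = fun x => c * Tc lam b f x + Tc lam b g x := by
  funext x
  simp only [Tc, Finset.mul_sum, ← Finset.sum_add_distrib]
  exact Finset.sum_congr rfl fun r _ => by ring

lemma Tc_sum {lam b : Fin d → ℝ} {ι : Type*} (s : Finset ι) (c : ι → ℝ)
    (f : ι → (Fin d → ℕ) → ℝ) :
    Tc lam b (fun x => ∑ i ∈ s, c i * f i x) = fun x => ∑ i ∈ s, c i * Tc lam b (f i) x := by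
  induction s using Finset.induction_on with
  | empty => funext x; simp [Tc]
  | insert a s ha ih =>
    simp only [Finset.sum_insert ha]
    rw [Tc_add, ih]

lemma ccr {lam : Fin d → ℝ} (hl : ∀ r, 0 < lam r) (a b : Fin d → ℝ) (f : (Fin d → ℕ) → ℝ) :
    Da a (Tc lam b f) = fun x => ip lam a b * f x + Tc lam b (Da a f) x := by
  funext x
  have key : ∀ r s : Fin d,
      (((x + Pi.single r 1 : Fin d → ℕ) s : ℝ) / lam s * f (x + Pi.single r 1 - Pi.single s 1)
        - f (x + Pi.single r 1)) - ((x s : ℝ) / lam s * f (x - Pi.single s 1) - f x) =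
      (if r = s then f x / lam s else 0) +
      ((x s : ℝ) / lam s * (f (x - Pi.single s 1 + Pi.single r 1) - f (x - Pi.single s 1))
        - (f (x + Pi.single r 1) - f x)) := by
    intro r s
    have hls := (hl s).ne'
    by_cases h : r = s
    · subst h
      simp only [add_tsub_cancel_right, if_true]
      by_cases h0 : x r = 0
      · simp [h0]; ring
      · have : x - Pi.single r 1 + Pi.single r 1 = x := by
          refine tsub_add_cancel_of_le ?_
          intro s
          by_cases h : s = r
          · subst h; simp; omega
          · simp [Pi.single_eq_of_ne h]
        rw [this]
        simp; ring
    · have h1 : x + Pi.single r 1 - Pi.single s 1 = x - Pi.single s 1 + Pi.single r 1 := by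
        funext t
        by_cases ht : t = s
        · subst ht
          simp [Pi.single_eq_of_ne (Ne.symm h)]
        · simp [Pi.single_eq_of_ne ht]
      have h2 : (x + Pi.single r 1 : Fin d → ℕ) s = x s := by
        simp [Pi.single_eq_of_ne (Ne.symm h)]
      rw [h1, h2, if_neg h]
      ring
  have lhs : Da a (Tc lam b f) x = ∑ r, ∑ s, a r * b s *
      ((((x + Pi.single r 1 : Fin d → ℕ) s : ℝ) / lam s * f (x + Pi.single r 1 - Pi.single s 1)
        - f (x + Pi.single r 1)) - ((x s : ℝ) / lam s * f (x - Pi.single s 1) - f x)) := by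
    simp only [Da, Tc, ← Finset.sum_sub_distrib, Finset.mul_sum]
    exact Finset.sum_congr rfl fun r _ => Finset.sum_congr rfl fun s _ => by ring
  have rhs : Tc lam b (Da a f) x = ∑ r, ∑ s, a r * b s *
      ((x s : ℝ) / lam s * (f (x - Pi.single s 1 + Pi.single r 1) - f (x - Pi.single s 1))
        - (f (x + Pi.single r 1) - f x)) := by
    simp only [Da, Tc, ← Finset.sum_sub_distrib, Finset.mul_sum]
    rw [Finset.sum_comm]
    exact Finset.sum_congr rfl fun r _ => Finset.sum_congr rfl fun s _ => by ring
  rw [lhs, rhs, ip, Finset.sum_mul, ← Finset.sum_add_distrib]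
  refine Finset.sum_congr rfl fun r _ => ?_
  simp only [key, mul_add, Finset.sum_add_distrib]
  congr 1
  simp
  ring

end Pois

end PaperL1
namespace PaperL1

section Chaos

variable {d : ℕ}

/-- iterated creation. -/
def chaos (lam : Fin d → ℝ) (l : List (Fin d → ℝ)) : (Fin d → ℕ) → ℝ :=
  l.foldr (Tc lam) (fun _ => 1)

lemma chaos_good (lam : Fin d → ℝ) (l : List (Fin d → ℝ)) : Good (chaos lam l) := by
  induction l with
  | nil => exact Good.const 1
  | cons b l ih => exact ih.Tc

lemma ip_self_nonneg {lam : Fin d → ℝ} (hl : ∀ r, 0 < lam r) (a : Fin d → ℝ) :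
    0 ≤ ip lam a a :=
  Finset.sum_nonneg fun r _ => div_nonneg (mul_self_nonneg _) (hl r).le

lemma ip_sq_le {lam : Fin d → ℝ} (hl : ∀ r, 0 < lam r) (a b : Fin d → ℝ) :
    ip lam a b ^ 2 ≤ ip lam a a * ip lam b b := by
  refine Finset.sum_sq_le_sum_mul_sum_of_sq_le_mul _
    (fun r _ => div_nonneg (mul_self_nonneg _) (hl r).le)
    (fun r _ => div_nonneg (mul_self_nonneg _) (hl r).le) (fun r _ => le_of_eq ?_)
  ring

lemma Da_chaos {lam : Fin d → ℝ} (hl : ∀ r, 0 < lam r) (a : Fin d → ℝ) (l : List (Fin d → ℝ)) :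
    Da a (chaos lam l) =
      fun x => ∑ i : Fin l.length, ip lam a l[i] * chaos lam (l.eraseIdx i) x := by
  induction l with
  | nil => funext x; simp [chaos, Da]
  | cons b l ih =>
    have h : chaos lam (b :: l) = Tc lam b (chaos lam l) := rfl
    rw [h, ccr hl, ih, Tc_sum]
    funext x
    exact (Fin.sum_univ_succ (n := l.length)
      (fun i => ip lam a (b :: l)[i] * chaos lam ((b :: l).eraseIdx i) x)).symm

lemma chaos_sq_le {lam : Fin d → ℝ} (hl : ∀ r, 0 < lam r) :
    ∀ (m : ℕ) (l : List (Fin d → ℝ)), l.length = m →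
      Ex lam (fun x => chaos lam l x ^ 2) ≤
        (m.factorial : ℝ) * (l.map fun b => ip lam b b).prod := by
  intro m
  induction m using Nat.strong_induction_on with
  | _ m IH =>
  intro l hlen
  cases l with
  | nil =>
    simp only [List.length_nil] at hlen
    subst hlen
    simp [chaos, Ex_one]
  | cons b l =>
    simp only [List.length_cons] at hlen
    subst hlen
    have hφ := chaos_good lam l
    set φ := chaos lam l with hφdef
    set P := (l.map fun b => ip lam b b).prod with hP
    have hP0 : 0 ≤ P := by
      refine List.prod_nonneg ?_
      intro y hy
      obtain ⟨c, _, rfl⟩ := List.mem_map.mp hy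
      exact ip_self_nonneg hl c
    have hb0 := ip_self_nonneg hl b
    have e1 : (fun x => chaos lam (b :: l) x ^ 2) = fun x => Tc lam b φ x * Tc lam b φ x := by
      funext x; rw [sq]; rfl
    have e2 : (fun x => φ x * Da b (Tc lam b φ) x) =
        fun x => ip lam b b * (φ x ^ 2) + Tc lam b (Da b φ) x * φ x := by
      funext x
      rw [ccr hl]; ring
    have gsq : ∀ {f : (Fin d → ℕ) → ℝ}, Good f → Good (fun x => f x ^ 2) := by
      intro f hf; simpa [sq] using hf.mul hf
    rw [e1, adj hl b hφ hφ.Tc, e2, Ex_add hl ((Good.const _).mul (gsq hφ)) (hφ.Da.Tc.mul hφ),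
      Ex_smul, adj hl b hφ.Da hφ]
    have hA : Ex lam (fun x => φ x ^ 2) ≤ (l.length.factorial : ℝ) * P :=
      IH l.length (Nat.lt_succ_self _) l rfl
    have hB : Ex lam (fun x => Da b φ x * Da b φ x) ≤
        (l.length : ℝ) * ((l.length.factorial : ℝ) * (ip lam b b * P)) := by
      have gi : ∀ i : Fin l.length,
          Good (fun x => ip lam b l[i] ^ 2 * chaos lam (l.eraseIdx i) x ^ 2) := fun i =>
        (Good.const _).mul (gsq (chaos_good _ _))
      have s1 : Ex lam (fun x => Da b φ x * Da b φ x) ≤ Ex lam (fun x => (l.length : ℝ) *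
          ∑ i : Fin l.length, ip lam b l[i] ^ 2 * chaos lam (l.eraseIdx i) x ^ 2) := by
        refine Ex_mono hl (hφ.Da.mul hφ.Da) ((Good.const _).mul (Good.sum _ fun i _ => gi i)) ?_
        intro x
        rw [← sq, hφdef, Da_chaos hl]
        have := sq_sum_le_card_mul_sum_sq (s := (Finset.univ : Finset (Fin l.length)))
          (f := fun i => ip lam b l[i] * chaos lam (l.eraseIdx i) x)
        simpa [mul_pow] using this
      refine s1.trans ?_
      rw [Ex_smul, Ex_sum hl _ gi]
      refine mul_le_mul_of_nonneg_left ?_ (Nat.cast_nonneg _)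
      have each : ∀ i : Fin l.length,
          Ex lam (fun x => ip lam b l[i] ^ 2 * chaos lam (l.eraseIdx i) x ^ 2) ≤
          ((l.length - 1).factorial : ℝ) * (ip lam b b * P) := by
        intro i
        rw [Ex_smul]
        have hi := i.2
        have hlen' : (l.eraseIdx i).length = l.length - 1 := List.length_eraseIdx_of_lt hi
        have h1 := IH (l.length - 1) (by omega) (l.eraseIdx i) hlen'
        have h2 : ip lam l[i] l[i] * ((l.eraseIdx i).map fun b => ip lam b b).prod = P := by
          have := List.CommMonoid.mul_prod_eraseIdx (l := l.map fun b => ip lam b b) (i := i)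
            (by simp)
          rw [hP, ← this, List.eraseIdx_map]
          simp
        have h3 : 0 ≤ Ex lam (fun x => chaos lam (l.eraseIdx i) x ^ 2) :=
          Ex_nonneg hl fun x => sq_nonneg _
        calc ip lam b l[i] ^ 2 * Ex lam (fun x => chaos lam (l.eraseIdx i) x ^ 2)
            ≤ (ip lam b b * ip lam l[i] l[i]) *
              (((l.length - 1).factorial : ℝ) * ((l.eraseIdx i).map fun b => ip lam b b).prod) :=
              mul_le_mul (ip_sq_le hl _ _) h1 h3 (mul_nonneg hb0 (ip_self_nonneg hl _))
          _ = ((l.length - 1).factorial : ℝ) * (ip lam b b *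
              (ip lam l[i] l[i] * ((l.eraseIdx i).map fun b => ip lam b b).prod)) := by ring
          _ = _ := by rw [h2]
      refine (Finset.sum_le_sum fun i _ => each i).trans ?_
      rw [Finset.sum_const, Finset.card_univ, Fintype.card_fin, nsmul_eq_mul, ← mul_assoc]
      refine mul_le_mul_of_nonneg_right ?_ (mul_nonneg hb0 hP0)
      rcases Nat.eq_zero_or_pos l.length with h | h
      · rw [h]; simp
      · exact_mod_cast (Nat.mul_factorial_pred h.ne').le
    rw [List.map_cons, List.prod_cons, ← hP, Nat.factorial_succ]
    push_cast
    have := mul_le_mul_of_nonneg_left hA hb0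
    linarith

variable {A : Type*} [NormedCommRing A] [NormedAlgebra ℝ A] [CompleteSpace A]

/-- monomial. -/
def mon (U : Fin d → A) (x : Fin d → ℕ) : A := ∏ r, U r ^ x r

lemma mon_norm (h1 : ‖(1:A)‖ = 1) {U : Fin d → A} (hU : ∀ r, ‖U r‖ ≤ 1) (x : Fin d → ℕ) :
    ‖mon U x‖ ≤ 1 := by
  have : NormOneClass A := ⟨h1⟩
  refine (Finset.norm_prod_le _ _).trans ?_
  refine Finset.prod_le_one (fun _ _ => norm_nonneg _) fun r _ => ?_
  exact (norm_pow_le _ _).trans (pow_le_one₀ (norm_nonneg _) (hU r))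

lemma mon_up (U : Fin d → A) (x : Fin d → ℕ) (r : Fin d) :
    mon U (x + Pi.single r 1) = U r * mon U x := by
  unfold mon
  simp only [Pi.add_apply, pow_add, Finset.prod_mul_distrib]
  rw [mul_comm]
  congr 1
  rw [Finset.prod_eq_single r]
  · simp
  · intro s _ hs; simp [Pi.single_eq_of_ne hs]
  · simp

/-- substitution of `U` into the density `f`. -/
def Ph (lam : Fin d → ℝ) (U : Fin d → A) (f : (Fin d → ℕ) → ℝ) : A :=
  ∑' x, (pw lam x * f x) • mon U x

lemma Ph_summable {lam : Fin d → ℝ} (hl : ∀ r, 0 < lam r) (h1 : ‖(1:A)‖ = 1) {U : Fin d → A}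
    (hU : ∀ r, ‖U r‖ ≤ 1) {f : (Fin d → ℕ) → ℝ} (hf : Good f) :
    Summable (fun x => ‖(pw lam x * f x) • mon U x‖) ∧ ‖Ph lam U f‖ ≤ Ex lam (fun x => |f x|) := by
  have hb : ∀ x, ‖(pw lam x * f x) • mon U x‖ ≤ pw lam x * |f x| := by
    intro x
    rw [norm_smul, norm_mul, Real.norm_of_nonneg (pw_nonneg hl x), Real.norm_eq_abs]
    exact mul_le_of_le_one_right (mul_nonneg (pw_nonneg hl x) (abs_nonneg _)) (mon_norm h1 hU x)
  have hs := hf.abs.summable hl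
  have hn : Summable (fun x => ‖(pw lam x * f x) • mon U x‖) :=
    Summable.of_nonneg_of_le (fun _ => norm_nonneg _) hb hs
  exact ⟨hn, (norm_tsum_le_tsum_norm hn).trans (hn.tsum_le_tsum hb hs)⟩

lemma Ph_Tc {lam : Fin d → ℝ} (hl : ∀ r, 0 < lam r) (h1 : ‖(1:A)‖ = 1) {U : Fin d → A}
    (hU : ∀ r, ‖U r‖ ≤ 1) {f : (Fin d → ℕ) → ℝ} (hf : Good f) (b : Fin d → ℝ) :
    (∑ r, b r • (U r - 1)) * Ph lam U f = Ph lam U (Tc lam b f) := by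
  have hc : ∀ r, Good (fun x : Fin d → ℕ => (x r : ℝ) / lam r * f (x - Pi.single r 1)) := by
    intro r
    refine Good.mul ?_ (hf.dn r)
    simp only [div_eq_mul_inv]
    exact (Good.coord r).mul (Good.const _)
  have sm : ∀ {g : (Fin d → ℕ) → ℝ}, Good g → Summable (fun x => (pw lam x * g x) • mon U x) :=
    fun hg => (Ph_summable hl h1 hU hg).1.of_norm
  have e1 : Ph lam U (Tc lam b f) = ∑ r, b r • (Ph lam U
      (fun x : Fin d → ℕ => (x r : ℝ) / lam r * f (x - Pi.single r 1)) - Ph lam U f) := by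
    have : ∀ x, (pw lam x * Tc lam b f x) • mon U x = ∑ r, b r •
        ((pw lam x * ((x r : ℝ) / lam r * f (x - Pi.single r 1))) • mon U x
          - (pw lam x * f x) • mon U x) := by
      intro x
      simp only [Tc, Finset.mul_sum, Finset.sum_smul, ← sub_smul, smul_smul]
      exact Finset.sum_congr rfl fun r _ => by congr 1; ring
    simp only [Ph, this]
    rw [Summable.tsum_finsetSum fun r _ => ((sm (hc r)).sub (sm hf)).const_smul (b r)]
    refine Finset.sum_congr rfl fun r _ => ?_
    rw [((sm (hc r)).sub (sm hf)).tsum_const_smul, (sm (hc r)).tsum_sub (sm hf)]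
  rw [e1, Finset.sum_mul]
  refine Finset.sum_congr rfl fun r _ => ?_
  rw [smul_mul_assoc, sub_mul, one_mul]
  congr 2
  have := shift_sum hl f (mon U) r
  simp only [Ph]
  rw [← this, ← (sm hf).tsum_mul_left]
  refine tsum_congr fun x => ?_
  rw [mon_up, mul_smul_comm]

lemma Ph_one {lam : Fin d → ℝ} (U : Fin d → A) :
    Ph lam U (fun _ => 1) = NormedSpace.exp (∑ r, lam r • (U r - 1)) := by
  let _ : NormedAlgebra ℚ A := NormedAlgebra.restrictScalars ℚ ℝ A
  rw [NormedSpace.exp_sum]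
  have h1 : ∀ r, HasSum (fun k : ℕ => (Real.exp (-lam r) * (lam r ^ k / (k.factorial : ℝ))) • U r ^ k)
      (NormedSpace.exp (lam r • (U r - 1))) := by
    intro r
    have e : lam r • (U r - 1) = algebraMap ℝ A (-lam r) + lam r • U r := by
      rw [smul_sub, Algebra.algebraMap_eq_smul_one, neg_smul]; abel
    rw [e, NormedSpace.exp_add, ← NormedSpace.algebraMap_exp_comm, ← Real.exp_eq_exp_ℝ,
      ← Algebra.smul_def]
    have := (NormedSpace.exp_series_hasSum_exp' (𝕂 := ℝ) (lam r • U r)).const_smul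
      (Real.exp (-lam r))
    convert this using 1
    funext k
    rw [smul_pow, smul_smul, smul_smul]
    congr 1
    ring
  have h2 : ∀ r, Summable (fun k : ℕ =>
      ‖(Real.exp (-lam r) * (lam r ^ k / (k.factorial : ℝ))) • U r ^ k‖) := by
    intro r
    have := (NormedSpace.norm_expSeries_summable' (𝕂 := ℝ) (lam r • U r)).mul_left
      ‖Real.exp (-lam r)‖
    refine this.congr fun k => ?_
    rw [← norm_smul, smul_pow, smul_smul, smul_smul]
    congr 2
    ring
  have h3 := (hasSum_pi_prod d _ h2).2.tsum_eq
  have h4 : ∀ r, NormedSpace.exp (lam r • (U r - 1)) = _ := fun r => (h1 r).tsum_eq.symm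
  rw [Finset.prod_congr rfl fun r _ => h4 r, ← h3, Ph]
  refine tsum_congr fun x => ?_
  rw [pw, mon, mul_one, ← Finset.prod_smul]

lemma chaos_norm {lam : Fin d → ℝ} (hl : ∀ r, 0 < lam r) (h1 : ‖(1:A)‖ = 1) {U : Fin d → A}
    (hU : ∀ r, ‖U r‖ ≤ 1) (l : List (Fin d → ℝ)) :
    ‖(l.map fun b => ∑ r, b r • (U r - 1)).prod * NormedSpace.exp (∑ r, lam r • (U r - 1))‖ ≤
      Real.sqrt ((l.length.factorial : ℝ) * (l.map fun b => ip lam b b).prod) := by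
  have e : (l.map fun b => ∑ r, b r • (U r - 1)).prod * NormedSpace.exp (∑ r, lam r • (U r - 1)) =
      Ph lam U (chaos lam l) := by
    induction l with
    | nil => rw [List.map_nil, List.prod_nil, one_mul, ← Ph_one]; rfl
    | cons b l ih =>
      rw [List.map_cons, List.prod_cons, mul_assoc, ih, Ph_Tc hl h1 hU (chaos_good lam l)]
      rfl
  rw [e]
  refine (Ph_summable hl h1 hU (chaos_good lam l)).2.trans (Real.le_sqrt_of_sq_le ?_)
  exact (Ex_abs_sq hl (chaos_good lam l)).trans (chaos_sq_le hl _ l rfl)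

end Chaos

end PaperL1
namespace PaperL1

section Bound

lemma gterm_summable (t : ℝ) :
    Summable (fun m : ℕ => 2 * ((m:ℝ) + 1) * t ^ m / ((m + 2).factorial : ℝ)) := by
  have h := (Real.summable_pow_div_factorial |t|).mul_left 2
  refine Summable.of_norm_bounded h fun m => ?_
  rw [Real.norm_eq_abs, abs_div, abs_mul, abs_of_nonneg (by positivity : (0:ℝ) ≤ 2 * ((m:ℝ) + 1)),
    abs_pow, Nat.abs_cast, Nat.factorial_succ, Nat.factorial_succ]
  push_cast
  have h0 : (0:ℝ) < (m.factorial : ℝ) := by positivity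
  have ht : 0 ≤ |t| ^ m := by positivity
  rw [mul_div_assoc', div_le_div_iff₀ (by positivity) h0]
  have : (0:ℝ) ≤ |t| ^ m * m.factorial * (m + 1) * m := by positivity
  nlinarith [this, mul_nonneg (mul_nonneg ht h0.le) (by positivity : (0:ℝ) ≤ (m:ℝ) + 1)]

lemma gfun_nonneg {t : ℝ} (ht : 0 ≤ t) : 0 ≤ gfun t :=
  tsum_nonneg fun m => by positivity

variable {A : Type*} [NormedCommRing A] [NormedAlgebra ℝ A] [CompleteSpace A]

lemma V_bound (h1 : ‖(1:A)‖ = 1) (R : A) {t : ℝ} (ht : ‖R‖ ≤ t) :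
    ∃ W : A, (1 + R) * NormedSpace.exp (-R) - 1 = R ^ 2 * W ∧ ‖W‖ ≤ gfun t / 2 := by
  have : NormOneClass A := ⟨h1⟩
  have ht0 : 0 ≤ t := (norm_nonneg _).trans ht
  set y := -R with hy
  have hyt : ‖y‖ ≤ t := by rwa [hy, norm_neg]
  have hg := gterm_summable t
  have hb : ∀ m : ℕ, ‖(((m:ℝ) + 1) / ((m + 2).factorial : ℝ)) • y ^ m‖ ≤
      (2 * ((m:ℝ) + 1) * t ^ m / ((m + 2).factorial : ℝ)) / 2 := by
    intro m
    rw [norm_smul, Real.norm_of_nonneg (by positivity)]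
    have : ‖y ^ m‖ ≤ t ^ m := (norm_pow_le _ _).trans (pow_le_pow_left₀ (norm_nonneg _) hyt m)
    calc (((m:ℝ) + 1) / ((m + 2).factorial : ℝ)) * ‖y ^ m‖
        ≤ (((m:ℝ) + 1) / ((m + 2).factorial : ℝ)) * t ^ m := by gcongr
      _ = _ := by ring
  have hsn : Summable (fun m : ℕ => ‖(((m:ℝ) + 1) / ((m + 2).factorial : ℝ)) • y ^ m‖) :=
    Summable.of_nonneg_of_le (fun _ => norm_nonneg _) hb (hg.div_const 2)
  refine ⟨-∑' m : ℕ, (((m:ℝ) + 1) / ((m + 2).factorial : ℝ)) • y ^ m, ?_, ?_⟩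
  · have hE := NormedSpace.exp_series_hasSum_exp' (𝕂 := ℝ) y
    have hE1 := (hasSum_nat_add_iff' 1).mpr hE
    have hE2 := (hasSum_nat_add_iff' 2).mpr hE
    have hd := (hE1.mul_left y).sub hE2
    have hW := hsn.of_norm.hasSum.mul_left (y ^ 2)
    have heq : (fun m : ℕ => y ^ 2 * ((((m:ℝ) + 1) / ((m + 2).factorial : ℝ)) • y ^ m)) =
        fun m : ℕ => y * ((((m + 1).factorial : ℝ)⁻¹) • y ^ (m + 1)) -
          (((m + 2).factorial : ℝ)⁻¹) • y ^ (m + 2) := by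
      funext m
      rw [mul_smul_comm, mul_smul_comm, ← pow_succ', ← pow_add, add_comm 2 m, ← sub_smul]
      congr 1
      rw [Nat.factorial_succ (m + 1)]
      have : ((m + 1).factorial : ℝ) ≠ 0 := by positivity
      push_cast
      field_simp
      ring
    rw [heq] at hW
    have hu := hW.unique hd
    have hR : R = -y := by rw [hy, neg_neg]
    rw [hR, mul_neg, neg_sq, hu]
    simp [Finset.sum_range_succ]
    ring
  · rw [norm_neg]
    refine (norm_tsum_le_tsum_norm hsn).trans ((hsn.tsum_le_tsum hb (hg.div_const 2)).trans ?_)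
    rw [tsum_div_const]
    rfl

variable {d : ℕ}

/-- linear form in `U - 1`. -/
def Sf (U : Fin d → A) (b : Fin d → ℝ) : A := ∑ r, b r • (U r - 1)

lemma prod_bound {lam : Fin d → ℝ} (hl : ∀ r, 0 < lam r) (h1 : ‖(1:A)‖ = 1) {U : Fin d → A}
    (hU : ∀ r, ‖U r‖ ≤ 1) {ι : Type*} (a : ι → Fin d → ℝ) (B : ι → A) (β : ι → ℝ)
    (hβ : ∀ j, 0 ≤ β j) (hB : ∀ j, ‖B j‖ ≤ 8 * β j) (J : Finset ι) :
    ∀ (s : ℕ) (l : List (Fin d → ℝ)), l.length = 2 * s →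
    ‖(∏ j ∈ J, (Sf U (a j) ^ 2 + B j)) * ((l.map (Sf U)).prod *
        NormedSpace.exp (∑ r, lam r • (U r - 1)))‖ ≤
      Real.sqrt ((2 * (s + J.card)).factorial : ℝ) *
        (∏ j ∈ J, (ip lam (a j) (a j) + 4 * Real.sqrt 2 * β j)) *
        Real.sqrt (l.map fun b => ip lam b b).prod := by
  induction J using Finset.induction_on with
  | empty =>
    intro s l hs
    have := chaos_norm hl h1 hU l
    rw [hs, Real.sqrt_mul (Nat.cast_nonneg _)] at this
    rw [Finset.prod_empty, one_mul, Finset.prod_empty, mul_one, Finset.card_empty, add_zero]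
    exact this
  | insert j J hj ih =>
    intro s l hs
    set e := NormedSpace.exp (∑ r, lam r • (U r - 1)) with he
    set Pr := ∏ j ∈ J, (Sf U (a j) ^ 2 + B j) with hPr
    set P := ∏ j ∈ J, (ip lam (a j) (a j) + 4 * Real.sqrt 2 * β j) with hP
    set L := Real.sqrt (l.map fun b => ip lam b b).prod with hL
    have hP0 : 0 ≤ P := Finset.prod_nonneg fun j _ =>
      add_nonneg (ip_self_nonneg hl _) (mul_nonneg (by positivity) (hβ j))
    have hL0 : 0 ≤ L := Real.sqrt_nonneg _
    have i1 := ih (s + 1) (a j :: a j :: l) (by simp [hs]; ring)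
    have i2 := ih s l hs
    have hia := ip_self_nonneg hl (a j)
    have e1 : Real.sqrt ((a j :: a j :: l).map fun b => ip lam b b).prod =
        ip lam (a j) (a j) * L := by
      rw [List.map_cons, List.map_cons, List.prod_cons, List.prod_cons, ← mul_assoc,
        Real.sqrt_mul (mul_nonneg hia hia), Real.sqrt_mul_self hia]
    rw [e1] at i1
    have e2 : s + 1 + J.card = s + (insert j J).card := by
      rw [Finset.card_insert_of_notMem hj]; ring
    rw [e2] at i1
    set m := s + J.card with hm
    have e3 : s + (insert j J).card = m + 1 := by rw [← e2, hm]; ring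
    rw [e3] at i1 ⊢
    rw [Finset.prod_insert hj, Finset.prod_insert hj]
    have e4 : (Sf U (a j) ^ 2 + B j) * Pr * ((l.map (Sf U)).prod * e) =
        Pr * (((a j :: a j :: l).map (Sf U)).prod * e) + B j * (Pr * ((l.map (Sf U)).prod * e)) := by
      rw [List.map_cons, List.map_cons, List.prod_cons, List.prod_cons]; ring
    have hfac : 8 * Real.sqrt ((2 * m).factorial : ℝ) ≤
        4 * Real.sqrt 2 * Real.sqrt ((2 * (m + 1)).factorial : ℝ) := by
      rw [mul_assoc, ← Real.sqrt_mul (by norm_num)]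
      have h4 : Real.sqrt ((2 * m).factorial : ℝ) * 2 ≤
          Real.sqrt (2 * ((2 * (m + 1)).factorial : ℝ)) := by
        apply Real.le_sqrt_of_sq_le
        rw [mul_pow, Real.sq_sqrt (Nat.cast_nonneg _), show 2 * (m + 1) = 2 * m + 1 + 1 by ring,
          Nat.factorial_succ, Nat.factorial_succ]
        push_cast
        have : (0:ℝ) ≤ ((2 * m).factorial : ℝ) := Nat.cast_nonneg _
        have hm0 : (0:ℝ) ≤ (m:ℝ) := Nat.cast_nonneg _
        nlinarith [mul_nonneg this hm0, mul_nonneg (mul_nonneg this hm0) hm0]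
      linarith
    rw [e4]
    refine (norm_add_le _ _).trans ?_
    have i3 : ‖B j * (Pr * ((l.map (Sf U)).prod * e))‖ ≤
        (8 * β j) * (Real.sqrt ((2 * m).factorial : ℝ) * P * L) :=
      (norm_mul_le _ _).trans (mul_le_mul (hB j) i2 (norm_nonneg _)
        (mul_nonneg (by norm_num) (hβ j)))
    have i4 := mul_le_mul_of_nonneg_left hfac (mul_nonneg (mul_nonneg (hβ j) hP0) hL0)
    calc _ ≤ Real.sqrt ((2 * (m + 1)).factorial : ℝ) * P * (ip lam (a j) (a j) * L) +
          (8 * β j) * (Real.sqrt ((2 * m).factorial : ℝ) * P * L) := add_le_add i1 i3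
      _ ≤ _ := by linarith

lemma Sf_norm (h1 : ‖(1:A)‖ = 1) {U : Fin d → A} (hU : ∀ r, ‖U r‖ ≤ 1) {b : Fin d → ℝ}
    (hb : ∀ r, 0 ≤ b r) : ‖Sf U b‖ ≤ 2 * ∑ r, b r := by
  rw [Finset.mul_sum]
  refine norm_sum_le_of_le _ fun r _ => ?_
  rw [norm_smul, Real.norm_of_nonneg (hb r), mul_comm]
  refine mul_le_mul_of_nonneg_right ?_ (hb r)
  have := norm_sub_le (U r) 1
  rw [h1] at this
  linarith [hU r]

lemma esymm_le {ι : Type*} (s : Finset ι) (y : ι → ℝ) (hy : ∀ i, 0 ≤ y i) :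
    ∀ k : ℕ, ∑ J ∈ Finset.powersetCard k s, ∏ j ∈ J, y j ≤ (∑ j ∈ s, y j) ^ k / (k.factorial : ℝ) := by
  induction s using Finset.induction_on with
  | empty =>
    intro k
    cases k with
    | zero => simp
    | succ k =>
      rw [Finset.powersetCard_eq_empty.mpr (by simp)]
      simp
  | insert a s ha ih =>
    intro k
    cases k with
    | zero => simp
    | succ k =>
      rw [Finset.powersetCard_succ_insert ha, Finset.sum_union, Finset.sum_image,
        Finset.sum_insert ha]
      · have h1 : ∑ J ∈ Finset.powersetCard k s, ∏ j ∈ insert a J, y j =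
            y a * ∑ J ∈ Finset.powersetCard k s, ∏ j ∈ J, y j := by
          rw [Finset.mul_sum]
          refine Finset.sum_congr rfl fun J hJ => ?_
          rw [Finset.prod_insert]
          exact fun h => ha ((Finset.mem_powersetCard.mp hJ).1 h)
        rw [h1]
        set S := ∑ j ∈ s, y j
        have hS : 0 ≤ S := Finset.sum_nonneg fun j _ => hy j
        have h2 := ih (k + 1)
        have h3 := mul_le_mul_of_nonneg_left (ih k) (hy a)
        have h4 := pow_add_mul_le_add_pow (a := S) (b := y a) hS (by linarith [hy a]) (k + 1)
        have h5 : S ^ (k + 1) / ((k + 1).factorial : ℝ) + y a * (S ^ k / (k.factorial : ℝ)) ≤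
            (y a + S) ^ (k + 1) / ((k + 1).factorial : ℝ) := by
          have : y a * (S ^ k / (k.factorial : ℝ)) =
              ((k + 1) * y a * S ^ k) / ((k + 1).factorial : ℝ) := by
            rw [Nat.factorial_succ]
            push_cast
            have : (k.factorial : ℝ) ≠ 0 := by positivity
            field_simp
          rw [this, ← add_div]
          gcongr
          rw [add_comm (y a)]
          refine le_trans (le_of_eq ?_) h4
          simp
          ring
        linarith
      · intro J hJ K hK hJK
        have hJ' : a ∉ J := fun h => ha ((Finset.mem_powersetCard.mp hJ).1 h)
        have hK' : a ∉ K := fun h => ha ((Finset.mem_powersetCard.mp hK).1 h)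
        rw [← Finset.erase_insert hJ', ← Finset.erase_insert hK']
        exact congrArg (fun s => Finset.erase s a) hJK
      · rw [Finset.disjoint_left]
        intro J hJ hJ2
        obtain ⟨K, _, rfl⟩ := Finset.mem_image.mp hJ2
        exact ha ((Finset.mem_powersetCard.mp hJ).1 (Finset.mem_insert_self a K))

/-- coefficient sequence. -/
def cc (k : ℕ) : ℝ := Real.sqrt ((2 * k).factorial : ℝ) / (k.factorial : ℝ) * Real.sqrt 2 ^ k

lemma cc_nonneg (k : ℕ) : 0 ≤ cc k := by unfold cc; positivity

lemma cc_succ (k : ℕ) : cc (k + 1) ≤ cc k * (2 * Real.sqrt 2) := by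
  unfold cc
  have h4 : Real.sqrt ((2 * (k + 1)).factorial : ℝ) ≤
      Real.sqrt ((2 * k).factorial : ℝ) * (2 * (k + 1)) := by
    apply Real.sqrt_le_iff.mpr
    refine ⟨by positivity, ?_⟩
    rw [mul_pow, Real.sq_sqrt (Nat.cast_nonneg _), show 2 * (k + 1) = 2 * k + 1 + 1 by ring,
      Nat.factorial_succ, Nat.factorial_succ]
    push_cast
    have : (0:ℝ) ≤ ((2 * k).factorial : ℝ) := Nat.cast_nonneg _
    have hm0 : (0:ℝ) ≤ (k:ℝ) := Nat.cast_nonneg _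
    nlinarith [mul_nonneg this hm0, mul_nonneg (mul_nonneg this hm0) hm0]
  have h5 : Real.sqrt ((2 * (k + 1)).factorial : ℝ) / ((k + 1).factorial : ℝ) ≤
      Real.sqrt ((2 * k).factorial : ℝ) / (k.factorial : ℝ) * 2 := by
    rw [div_le_iff₀ (by positivity), Nat.factorial_succ]
    refine h4.trans (le_of_eq ?_)
    have : (k.factorial : ℝ) ≠ 0 := by positivity
    push_cast
    field_simp
  rw [pow_succ]
  have := mul_le_mul_of_nonneg_right h5 (by positivity : 0 ≤ Real.sqrt 2 ^ k * Real.sqrt 2)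
  refine this.trans (le_of_eq (by ring))

lemma cc_add (N i : ℕ) : cc (N + i) ≤ cc N * (2 * Real.sqrt 2) ^ i := by
  induction i with
  | zero => simp
  | succ i ih =>
    rw [← add_assoc, pow_succ, ← mul_assoc]
    exact (cc_succ _).trans (mul_le_mul_of_nonneg_right ih (by positivity))

lemma geom_bound {α : ℝ} (h0 : 0 ≤ α) (hα : 2 * Real.sqrt 2 * α < 1) (N M : ℕ) :
    ∑ k ∈ Finset.Ico N M, cc k * α ^ k ≤ cc N * α ^ N / (1 - 2 * Real.sqrt 2 * α) := by
  rw [Finset.sum_Ico_eq_sum_range]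
  have h1 : ∀ i ∈ Finset.range (M - N), cc (N + i) * α ^ (N + i) ≤
      cc N * α ^ N * (2 * Real.sqrt 2 * α) ^ i := by
    intro i _
    rw [pow_add, mul_pow _ α]
    have := mul_le_mul_of_nonneg_right (cc_add N i) (by positivity : 0 ≤ α ^ N * α ^ i)
    refine this.trans (le_of_eq (by ring))
  refine (Finset.sum_le_sum h1).trans ?_
  rw [← Finset.mul_sum, div_eq_mul_inv]
  refine mul_le_mul_of_nonneg_left ?_ (mul_nonneg (cc_nonneg _) (by positivity))
  have hρ : 0 ≤ 2 * Real.sqrt 2 * α := by positivity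
  rw [← tsum_geometric_of_lt_one hρ hα]
  exact (summable_geometric_of_lt_one hρ hα).sum_le_tsum _ fun i _ => by positivity

/-- The abstract Banach algebra version. -/
lemma abstract_bound (h1 : ‖(1:A)‖ = 1) {n : ℕ} (p : Fin n → ℝ) (q : Fin n → Fin d → ℝ)
    (hp : ∀ j, 0 ≤ p j) (hq : ∀ j r, 0 ≤ q j r) (hq1 : ∀ j, ∑ r, q j r = 1)
    (lam : Fin d → ℝ) (hlam : ∀ r, lam r = ∑ j, p j * q j r) (hl : ∀ r, 0 < lam r)
    (U : Fin d → A) (hU : ∀ r, ‖U r‖ ≤ 1) (R V : Fin n → A)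
    (hR : ∀ j, R j = p j • Sf U (q j))
    (hV : ∀ j, V j = (1 + R j) * NormedSpace.exp (-(R j)) - 1) (ℓ : ℕ) (hℓ : ℓ ≤ n) (α : ℝ)
    (hα : α = ∑ j, gfun (2 * p j) * (p j) ^ 2 *
      ∑ r, q j r * min (q j r / (2 * Real.sqrt 2 * lam r)) 2)
    (hsmall : 2 * Real.sqrt 2 * α < 1) :
    ‖∏ j, (1 + R j) - ∑ k ∈ Finset.range (ℓ + 1),
      (∑ J ∈ Finset.powersetCard k Finset.univ, ∏ j ∈ J, V j) * NormedSpace.exp (∑ j, R j)‖ ≤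
      cc (ℓ + 1) * α ^ (ℓ + 1) / (1 - 2 * Real.sqrt 2 * α) := by
  let _ : NormedAlgebra ℚ A := NormedAlgebra.restrictScalars ℚ ℝ A
  have h2 : (0:ℝ) < Real.sqrt 2 := by positivity
  have h22 : Real.sqrt 2 * Real.sqrt 2 = 2 := Real.mul_self_sqrt (by norm_num)
  set e := NormedSpace.exp (∑ j, R j) with he
  -- the exponent
  have hsumR : ∑ j, R j = ∑ r, lam r • (U r - 1) := by
    simp only [hR, Sf, Finset.smul_sum, smul_smul]
    rw [Finset.sum_comm]
    refine Finset.sum_congr rfl fun r _ => ?_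
    rw [hlam, Finset.sum_smul]
  set y : Fin n → ℝ := fun j => gfun (2 * p j) * (p j) ^ 2 *
      ∑ r, q j r * min (q j r / (2 * Real.sqrt 2 * lam r)) 2 with hy
  have hmin : ∀ j, 0 ≤ ∑ r, q j r * min (q j r / (2 * Real.sqrt 2 * lam r)) 2 := fun j =>
    Finset.sum_nonneg fun r _ => by
      have := hl r; have := hq j r; positivity
  have hy0 : ∀ j, 0 ≤ y j := fun j =>
    mul_nonneg (mul_nonneg (gfun_nonneg (by have := hp j; positivity)) (sq_nonneg _)) (hmin j)
  have hα0 : 0 ≤ α := by rw [hα]; exact Finset.sum_nonneg fun j _ => hy0 j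
  -- splitting
  let a : Fin n → Fin d → ℝ := fun j r => if q j r / (2 * Real.sqrt 2 * lam r) ≤ 2 then q j r else 0
  let b : Fin n → Fin d → ℝ := fun j r => if q j r / (2 * Real.sqrt 2 * lam r) ≤ 2 then 0 else q j r
  have ha0 : ∀ j r, 0 ≤ a j r := by
    intro j r; simp only [a]; split_ifs; exacts [hq j r, le_rfl]
  have hb0 : ∀ j r, 0 ≤ b j r := by
    intro j r; simp only [b]; split_ifs; exacts [le_rfl, hq j r]
  have hab : ∀ j r, a j r + b j r = q j r := by
    intro j r; simp only [a, b]; split_ifs <;> simp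
  let B : Fin n → A := fun j => Sf U (b j) * (Sf U (a j) + Sf U (q j))
  have hsplit : ∀ j, Sf U (q j) ^ 2 = Sf U (a j) ^ 2 + B j := by
    intro j
    have : Sf U (q j) = Sf U (a j) + Sf U (b j) := by
      simp only [Sf, ← Finset.sum_add_distrib, ← add_smul, hab]
    simp only [B, this]
    ring
  have hβ0 : ∀ j, 0 ≤ ∑ r, b j r := fun j => Finset.sum_nonneg fun r _ => hb0 j r
  have hBn : ∀ j, ‖B j‖ ≤ 8 * ∑ r, b j r := by
    intro j
    have n1 := Sf_norm h1 hU (hb0 j)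
    have n2 := Sf_norm h1 hU (ha0 j)
    have n3 := Sf_norm h1 hU (hq j)
    have n4 : ∑ r, a j r ≤ ∑ r, q j r := Finset.sum_le_sum fun r _ => by
      rw [← hab]; linarith [hb0 j r]
    rw [hq1] at n3 n4
    have n5 : ‖Sf U (a j) + Sf U (q j)‖ ≤ 4 := (norm_add_le _ _).trans (by linarith)
    calc ‖B j‖ ≤ ‖Sf U (b j)‖ * ‖Sf U (a j) + Sf U (q j)‖ := norm_mul_le _ _
      _ ≤ (2 * ∑ r, b j r) * 4 := mul_le_mul n1 n5 (norm_nonneg _) (by linarith [hβ0 j])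
      _ = _ := by ring
  have hsum : ∀ j, ip lam (a j) (a j) + 4 * Real.sqrt 2 * ∑ r, b j r =
      2 * Real.sqrt 2 * ∑ r, q j r * min (q j r / (2 * Real.sqrt 2 * lam r)) 2 := by
    intro j
    rw [ip, Finset.mul_sum, Finset.mul_sum, ← Finset.sum_add_distrib]
    refine Finset.sum_congr rfl fun r _ => ?_
    have hlr := (hl r).ne'
    simp only [a, b]
    split_ifs with h
    · rw [min_eq_left h]
      field_simp
      ring
    · rw [min_eq_right (not_le.mp h).le]
      ring
  have hVb : ∀ j, ∃ W : A, V j = R j ^ 2 * W ∧ ‖W‖ ≤ gfun (2 * p j) / 2 := by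
    intro j
    rw [hV]
    refine V_bound h1 (R j) ?_
    have n3 := Sf_norm h1 hU (hq j)
    rw [hq1] at n3
    rw [hR, norm_smul, Real.norm_of_nonneg (hp j)]
    nlinarith [hp j]
  choose W hW hWn using hVb
  have hJ : ∀ J : Finset (Fin n), ‖(∏ j ∈ J, V j) * e‖ ≤
      Real.sqrt ((2 * J.card).factorial : ℝ) * Real.sqrt 2 ^ J.card * ∏ j ∈ J, y j := by
    intro J
    have e1 : (∏ j ∈ J, V j) * e = (∏ j ∈ J, (p j ^ 2) • W j) *
        ((∏ j ∈ J, (Sf U (a j) ^ 2 + B j)) * e) := by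
      rw [← mul_assoc, ← Finset.prod_mul_distrib]
      congr 1
      refine Finset.prod_congr rfl fun j _ => ?_
      rw [hW, hR, ← hsplit, smul_pow, smul_mul_assoc, smul_mul_assoc, mul_comm]
    have hb := prod_bound hl h1 hU a B (fun j => ∑ r, b j r) hβ0 hBn J 0 [] rfl
    simp only [List.map_nil, List.prod_nil, one_mul, Real.sqrt_one, mul_one, zero_add] at hb
    rw [← hsumR, ← he] at hb
    have hn : ‖∏ j ∈ J, (p j ^ 2) • W j‖ ≤ ∏ j ∈ J, (p j ^ 2 * (gfun (2 * p j) / 2)) := by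
      have : NormOneClass A := ⟨h1⟩
      refine (Finset.norm_prod_le _ _).trans ?_
      refine Finset.prod_le_prod (fun _ _ => norm_nonneg _) fun j _ => ?_
      rw [norm_smul, Real.norm_of_nonneg (sq_nonneg _)]
      exact mul_le_mul_of_nonneg_left (hWn j) (sq_nonneg _)
    rw [e1]
    refine (norm_mul_le _ _).trans ((mul_le_mul hn hb (norm_nonneg _)
      ((norm_nonneg _).trans hn)).trans (le_of_eq ?_))
    rw [mul_left_comm, ← Finset.prod_mul_distrib, mul_assoc]
    congr 1
    rw [← Finset.prod_const, ← Finset.prod_mul_distrib]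
    refine Finset.prod_congr rfl fun j _ => ?_
    rw [hsum]
    simp only [hy]
    ring
  have hHk : ∀ k, ‖(∑ J ∈ Finset.powersetCard k Finset.univ, ∏ j ∈ J, V j) * e‖ ≤
      cc k * α ^ k := by
    intro k
    rw [Finset.sum_mul]
    refine (norm_sum_le_of_le _ fun J _ => hJ J).trans ?_
    have : ∑ J ∈ Finset.powersetCard k Finset.univ, Real.sqrt ((2 * J.card).factorial : ℝ) *
        Real.sqrt 2 ^ J.card * ∏ j ∈ J, y j = Real.sqrt ((2 * k).factorial : ℝ) *
        Real.sqrt 2 ^ k * ∑ J ∈ Finset.powersetCard k Finset.univ, ∏ j ∈ J, y j := by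
      rw [Finset.mul_sum]
      refine Finset.sum_congr rfl fun J hJ => ?_
      rw [(Finset.mem_powersetCard.mp hJ).2]
    rw [this]
    have h3 := esymm_le Finset.univ y hy0 k
    rw [← hα] at h3
    refine (mul_le_mul_of_nonneg_left h3 (by positivity)).trans (le_of_eq ?_)
    unfold cc
    ring
  have hF : ∏ j, (1 + R j) = ∑ k ∈ Finset.range (n + 1),
      (∑ J ∈ Finset.powersetCard k Finset.univ, ∏ j ∈ J, V j) * e := by
    have f1 : ∀ j, 1 + R j = (1 + V j) * NormedSpace.exp (R j) := by
      intro j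
      rw [hV, add_sub_cancel, mul_assoc, ← NormedSpace.exp_add, neg_add_cancel,
        NormedSpace.exp_zero, mul_one]
    rw [Finset.prod_congr rfl fun j _ => f1 j, Finset.prod_mul_distrib, ← NormedSpace.exp_sum, ← he,
      Finset.prod_one_add, Finset.sum_powerset, Finset.card_univ, Fintype.card_fin, Finset.sum_mul]
  rw [hF, ← Finset.sum_Ico_eq_sub _ (by omega : ℓ + 1 ≤ n + 1)]
  exact (norm_sum_le_of_le _ fun k _ => hHk k).trans (geom_bound hα0 hsmall _ _)

end Bound

end PaperL1

/-- Theorem 2 of Roos: approximation of a convolution `F` of distributions by the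
higher-order signed measures `G_ℓ = Σ_{k=0}^ℓ M_k exp(λ(Q - δ₀))`; if
`α₁ < 2^{-3/2}` then
`‖F - G_ℓ‖ ≤ (√((2(ℓ+1))!)/(ℓ+1)!) 2^{(ℓ+1)/2} α₁^{ℓ+1}/(1 - 2^{3/2} α₁)`. -/
theorem compound_poisson_higher_order_alpha_bound
    {X : Type*} [AddCommMonoid X] [Countable X]
    (d n : ℕ) (hd : 1 ≤ d) (hn : 1 ≤ n)
    (p : Fin n → ℝ) (q : Fin n → Fin d → ℝ)
    (hp : ∀ j, p j ∈ Set.Icc (0:ℝ) 1)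
    (hq : ∀ j r, q j r ∈ Set.Icc (0:ℝ) 1)
    (hq1 : ∀ j, ∑ r, q j r = 1)
    (lam : Fin d → ℝ) (hlam : ∀ r, lam r = ∑ j, p j * q j r)
    (hlampos : ∀ r, 0 < lam r)
    (U : Fin d → X → ℝ) (hU : ∀ r, IsPmf (U r))
    (Q : Fin n → X → ℝ) (hQ : ∀ j, Q j = ∑ r, q j r • U r)
    (lamtot : ℝ) (hlamtot : lamtot = ∑ j, p j)
    (Qbar : X → ℝ) (hQbar : Qbar = lamtot⁻¹ • ∑ j, p j • Q j)
    (R : Fin n → X → ℝ) (hR : ∀ j, R j = p j • (Q j - delta 0))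
    (Fj : Fin n → X → ℝ) (hFj : ∀ j, Fj j = delta 0 + R j)
    (V : Fin n → X → ℝ) (hV : ∀ j, V j = conv (Fj j) (convExp (-(R j))) - delta 0)
    (F : X → ℝ) (hF : F = convProd Finset.univ Fj)
    (M : ℕ → X → ℝ)
    (hM : ∀ k, M k = ∑ J ∈ Finset.powersetCard k Finset.univ, convProd J V)
    (H : ℕ → X → ℝ)
    (hH : ∀ k, H k = conv (M k) (convExp (lamtot • (Qbar - delta 0))))
    (ℓ : ℕ) (hℓ : ℓ ≤ n)
    (Gl : X → ℝ) (hGl : Gl = ∑ k ∈ Finset.range (ℓ + 1), H k)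
    (α₁ : ℝ)
    (hα₁ : α₁ = ∑ j, gfun (2 * p j) * (p j) ^ 2 *
      ∑ r, q j r * min (q j r / ((2:ℝ) ^ ((3:ℝ)/2) * lam r)) 2)
    (hsmall : α₁ < (2:ℝ) ^ (-(3:ℝ)/2)) :
    l1norm (F - Gl) ≤
      Real.sqrt ((2 * (ℓ + 1)).factorial : ℝ) / (((ℓ + 1).factorial : ℝ)) *
        (2:ℝ) ^ (((ℓ:ℝ) + 1) / 2) * α₁ ^ (ℓ + 1) / (1 - (2:ℝ) ^ ((3:ℝ)/2) * α₁) := by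
  have h2 : (0:ℝ) < Real.sqrt 2 := by positivity
  have e32 : (2:ℝ) ^ ((3:ℝ)/2) = 2 * Real.sqrt 2 := by
    rw [show (3:ℝ)/2 = 1 + 1/2 by norm_num, Real.rpow_add (by norm_num), Real.rpow_one,
      Real.sqrt_eq_rpow]
  have em32 : (2:ℝ) ^ (-(3:ℝ)/2) = (2 * Real.sqrt 2)⁻¹ := by
    rw [neg_div, Real.rpow_neg (by norm_num), e32]
  have el : (2:ℝ) ^ (((ℓ:ℝ) + 1) / 2) = Real.sqrt 2 ^ (ℓ + 1) := by
    rw [Real.sqrt_eq_rpow, ← Real.rpow_natCast, ← Real.rpow_mul (by norm_num)]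
    congr 1
    push_cast
    ring
  rw [e32] at hα₁ ⊢
  rw [em32] at hsmall
  have hsm : 2 * Real.sqrt 2 * α₁ < 1 := by
    have := mul_lt_mul_of_pos_left hsmall (by positivity : 0 < 2 * Real.sqrt 2)
    rwa [mul_inv_cancel₀ (by positivity)] at this
  let U' : Fin d → L1 X := fun r => L1.mk (U r) (hU r).2.summable
  have hU'fn : ∀ r, (U' r).fn = U r := fun r => L1.fn_mk _ _
  have hU' : ∀ r, ‖U' r‖ ≤ 1 := by
    intro r
    rw [L1.norm_def, hU'fn, l1norm]
    have : (fun x => |U r x|) = U r := funext fun x => abs_of_nonneg ((hU r).1 x)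
    rw [this, (hU r).2.tsum_eq]
  let R' : Fin n → L1 X := fun j => p j • Sf U' (q j)
  have hR' : ∀ j, (R' j).fn = R j := by
    intro j
    simp only [R', Sf, L1.fn_smul, L1.fn_sum, L1.fn_sub, L1.fn_one, hU'fn]
    rw [hR, hQ]
    simp only [smul_sub, Finset.sum_sub_distrib]
    rw [← Finset.sum_smul, hq1, one_smul]
  let V' : Fin n → L1 X := fun j => (1 + R' j) * NormedSpace.exp (-(R' j)) - 1
  have hFj' : ∀ j, (1 + R' j).fn = Fj j := by
    intro j
    rw [L1.fn_add, L1.fn_one, hR', hFj]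
  have hV' : ∀ j, (V' j).fn = V j := by
    intro j
    simp only [V']
    rw [L1.fn_sub, L1.fn_mul, L1.fn_exp, L1.fn_neg, hFj', hR', L1.fn_one, hV]
  have hF' : (∏ j, (1 + R' j)).fn = F := by
    rw [L1.fn_prod, hF]
    simp only [hFj']
  have hM' : ∀ k, (∑ J ∈ Finset.powersetCard k Finset.univ, ∏ j ∈ J, V' j).fn = M k := by
    intro k
    rw [L1.fn_sum, hM]
    simp only [L1.fn_prod, hV']
  have hlt : lamtot ≠ 0 := by
    have h3 : lamtot = ∑ r, lam r := by
      rw [hlamtot]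
      simp only [hlam]
      rw [Finset.sum_comm]
      refine Finset.sum_congr rfl fun j _ => ?_
      rw [← Finset.mul_sum, hq1, mul_one]
    rw [h3]
    exact (Finset.sum_pos (fun r _ => hlampos r) ⟨⟨0, hd⟩, Finset.mem_univ _⟩).ne'
  have hE' : (∑ j, R' j).fn = lamtot • (Qbar - delta 0) := by
    rw [L1.fn_sum, smul_sub, hQbar, smul_smul, mul_inv_cancel₀ hlt, one_smul, hlamtot,
      Finset.sum_smul, ← Finset.sum_sub_distrib]
    refine Finset.sum_congr rfl fun j _ => ?_
    rw [hR', hR, smul_sub]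
  have hH' : ∀ k, ((∑ J ∈ Finset.powersetCard k Finset.univ, ∏ j ∈ J, V' j) *
      NormedSpace.exp (∑ j, R' j)).fn = H k := by
    intro k
    rw [L1.fn_mul, hM', L1.fn_exp, hE', hH]
  have key := abstract_bound (A := L1 X) L1.norm_one' p q (fun j => (hp j).1)
    (fun j r => (hq j r).1) hq1 lam hlam hlampos U' hU' R' V' (fun _ => rfl) (fun _ => rfl)
    ℓ hℓ α₁ hα₁ hsm
  rw [L1.norm_def, L1.fn_sub, hF', L1.fn_sum] at key
  simp only [hH'] at key
  rw [← hGl] at key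
  rw [el]
  exact key
end
end

section
/- Let X be a countable commutative additive monoid, d, n ≥ 1 integers and ℓ ∈ {0,1,2,3,4} with ℓ ≤ n. For j ∈ {1,…,n} and r ∈ {1,…,d}, let p_j, q_{j,r} ∈ [0,1] with Σ_{r=1}^d q_{j,r} = 1 and λ_r := Σ_{j=1}^n p_j q_{j,r} > 0, and let U_r be probability mass functions in ℓ¹(X). Set Q_j = Σ_{r=1}^d q_{j,r} U_r, λ = Σ_{j=1}^n p_j, Q = (1/λ) Σ_{j=1}^n p_j Q_j, R_j = p_j(Q_j − δ₀), F_j = δ₀ + R_j, V_j = F_j * exp(−R_j) − δ₀, F = ∏_{j=1}^n F_j, and for k ∈ {0,…,n}, M_k = Σ_{J⊆{1,…,n}, |J|=k} ∏_{j∈J} V_j, H_k = M_k * exp(λ(Q − δ₀)), G_ℓ = Σ_{k=0}^ℓ H_k. Set β₁ = Σ_{j=1}^n p_j² Σ_{r=1}^d q_{j,r} · min{ q_{j,r}/λ_r, 1 }. Then ‖F − G_ℓ‖ ≤ c_ℓ · β₁^{ℓ+1}, where c₀ = 15.6, c₁ = 113.0, c₂ = 633.8, c₃ = 3204.8 and c₄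 = 15945.6. -/
open scoped Classical BigOperators

noncomputable section

open PaperL1

set_option linter.unusedSectionVars false
namespace CPB

section General

variable {A : Type*} [NormedRing A] [NormedAlgebra ℝ A] [CompleteSpace A]

theorem exp_add_comm' {x y : A} (h : Commute x y) :
    NormedSpace.exp (x + y) = NormedSpace.exp x * NormedSpace.exp y := by
  let _ : NormedAlgebra ℚ A := NormedAlgebra.restrictScalars ℚ ℝ A
  exact NormedSpace.exp_add_of_commute h

theorem norm_exp_le' [NormOneClass A] (x : A) : ‖NormedSpace.exp x‖ ≤ Real.exp ‖x‖ := by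
  have h1 := NormedSpace.exp_series_hasSum_exp' (𝕂 := ℝ) x
  have h2 := NormedSpace.exp_series_hasSum_exp' (𝕂 := ℝ) (‖x‖ : ℝ)
  rw [← Real.exp_eq_exp_ℝ] at h2
  rw [← h1.tsum_eq]
  refine tsum_of_norm_bounded h2 fun n => ?_
  rw [norm_smul, smul_eq_mul, norm_inv, Real.norm_natCast]
  gcongr
  exact norm_pow_le x n

theorem norm_exp_sub_le_one [NormOneClass A] (x : A) (c : ℝ) (h : ‖x‖ ≤ c) :
    ‖NormedSpace.exp (x - c • (1 : A))‖ ≤ 1 := by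
  have hc : Commute x (-(c • (1 : A))) :=
    ((Commute.one_right x).smul_right c).neg_right
  rw [sub_eq_add_neg, exp_add_comm' hc]
  have h3 : NormedSpace.exp (-(c • (1 : A))) = Real.exp (-c) • (1 : A) := by
    have := NormedSpace.algebraMap_exp_comm (𝔸 := A) (-c)
    rw [← Real.exp_eq_exp_ℝ] at this
    rw [Algebra.algebraMap_eq_smul_one, Algebra.algebraMap_eq_smul_one] at this
    rw [this, neg_smul]
  rw [h3, mul_smul_comm, mul_one, norm_smul, Real.norm_eq_abs, Real.abs_exp]
  calc Real.exp (-c) * ‖NormedSpace.exp x‖ ≤ Real.exp (-c) * Real.exp c := by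
        gcongr
        exact (norm_exp_le' x).trans (Real.exp_le_exp.2 h)
    _ = 1 := by rw [← Real.exp_add]; simp

end General

section Op

variable {E : Type*} [NormedAddCommGroup E] [NormedSpace ℝ E] [CompleteSpace E]

def expE (L : E →L[ℝ] E) (t : ℝ) : E →L[ℝ] E := NormedSpace.exp (t • L)

theorem expE_zero (L : E →L[ℝ] E) (x : E) : expE L 0 x = x := by simp [expE]

theorem expE_deriv (L : E →L[ℝ] E) (t : ℝ) :
    HasDerivAt (fun t => expE L t) ((expE L t).comp L) t :=
  hasDerivAt_exp_smul_const L t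

theorem expE_norm [Nontrivial E] (M : E →L[ℝ] E) (c t : ℝ) (h : ‖M‖ ≤ c) (ht : 0 ≤ t) :
    ‖expE (M - c • ContinuousLinearMap.id ℝ E) t‖ ≤ 1 := by
  rw [expE, smul_sub, smul_smul]
  apply norm_exp_sub_le_one
  rw [norm_smul, Real.norm_of_nonneg ht]
  gcongr

end Op

section Smooth

open BoundedContinuousFunction

variable {A : Type*} [NormedCommRing A] [NormedAlgebra ℝ A] [CompleteSpace A] [NormOneClass A]

/-- The closed unit ball of the algebra. -/
abbrev Ball (A : Type*) [NormedCommRing A] := Metric.closedBall (0 : A) 1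

def mulMap (u : A) (hu : ‖u‖ ≤ 1) : C(Ball A, Ball A) where
  toFun x := ⟨u * x.1, by
    have hx := x.2
    simp only [Metric.mem_closedBall, dist_zero_right] at hx ⊢
    calc ‖u * x.1‖ ≤ ‖u‖ * ‖x.1‖ := norm_mul_le _ _
      _ ≤ 1 * 1 := by gcongr
      _ = 1 := by norm_num⟩
  continuous_toFun := by fun_prop

def ballOne : Ball A := ⟨1, by simp⟩

theorem kmap_aux (φ : A →L[ℝ] ℝ) (c : A) (x : Ball A) : ‖φ (c * x.1)‖ ≤ ‖φ‖ * ‖c‖ := by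
  have hx := x.2
  simp only [Metric.mem_closedBall, dist_zero_right] at hx
  calc ‖φ (c * x.1)‖ ≤ ‖φ‖ * ‖c * x.1‖ := φ.le_opNorm _
    _ ≤ ‖φ‖ * (‖c‖ * ‖x.1‖) := by gcongr; exact norm_mul_le _ _
    _ ≤ ‖φ‖ * (‖c‖ * 1) := by gcongr
    _ = _ := by ring

/-- `K φ c` is the function `x ↦ φ (c x)` on the unit ball. -/
def Kmap (φ : A →L[ℝ] ℝ) : A →L[ℝ] (Ball A →ᵇ ℝ) :=
  LinearMap.mkContinuous
    { toFun := fun c => BoundedContinuousFunction.ofNormedAddCommGroup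
        (fun x : Ball A => φ (c * x.1)) (by fun_prop) (‖φ‖ * ‖c‖) (kmap_aux φ c)
      map_add' := by intro a b; ext x; simp [add_mul]
      map_smul' := by intro a b; ext x; simp }
    ‖φ‖ (fun c => BoundedContinuousFunction.norm_ofNormedAddCommGroup_le (f := fun x : Ball A => φ (c * x.1)) (by fun_prop) (by positivity) (kmap_aux φ c))

theorem Kmap_apply (φ : A →L[ℝ] ℝ) (c : A) (x : Ball A) : Kmap φ c x = φ (c * x.1) := rfl

theorem Kmap_norm_le (φ : A →L[ℝ] ℝ) (c : A) : ‖Kmap φ c‖ ≤ ‖φ‖ * ‖c‖ :=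
  BoundedContinuousFunction.norm_ofNormedAddCommGroup_le (f := fun x : Ball A => φ (c * x.1))
    (by fun_prop) (by positivity) (kmap_aux φ c)

variable {d : ℕ}

/-- shift operator on bounded functions -/
def Sop (u : A) (hu : ‖u‖ ≤ 1) : (Ball A →ᵇ ℝ) →L[ℝ] (Ball A →ᵇ ℝ) :=
  compContinuousCLM ℝ ℝ (mulMap u hu)

theorem Sop_apply (u : A) (hu : ‖u‖ ≤ 1) (f : Ball A →ᵇ ℝ) (x : Ball A) :
    Sop u hu f x = f (mulMap u hu x) := rfl

def Lop (lam : Fin d → ℝ) (U : Fin d → A) (hU : ∀ r, ‖U r‖ ≤ 1) :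
    (Ball A →ᵇ ℝ) →L[ℝ] (Ball A →ᵇ ℝ) :=
  (∑ r, lam r • Sop (U r) (hU r)) - (∑ r, lam r) • ContinuousLinearMap.id ℝ (Ball A →ᵇ ℝ)

theorem Lop_apply (lam : Fin d → ℝ) (U : Fin d → A) (hU : ∀ r, ‖U r‖ ≤ 1)
    (f : Ball A →ᵇ ℝ) (x : Ball A) :
    Lop lam U hU f x = ∑ r, lam r * (f (mulMap (U r) (hU r) x) - f x) := by
  simp [Lop, Sop, mul_sub, Finset.sum_sub_distrib, Finset.sum_mul]

def Pop (lam : Fin d → ℝ) (U : Fin d → A) (hU : ∀ r, ‖U r‖ ≤ 1) (t : ℝ) :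
    (Ball A →ᵇ ℝ) →L[ℝ] (Ball A →ᵇ ℝ) := expE (Lop lam U hU) t

theorem Lop_one (lam : Fin d → ℝ) (U : Fin d → A) (hU : ∀ r, ‖U r‖ ≤ 1) :
    Lop lam U hU 1 = 0 := by
  ext x
  rw [Lop_apply]; simp

theorem Pop_deriv (lam : Fin d → ℝ) (U : Fin d → A) (hU : ∀ r, ‖U r‖ ≤ 1) (t : ℝ) :
    HasDerivAt (fun t => Pop lam U hU t) ((Pop lam U hU t).comp (Lop lam U hU)) t :=
  expE_deriv _ _

theorem Pop_zero (lam : Fin d → ℝ) (U : Fin d → A) (hU : ∀ r, ‖U r‖ ≤ 1) :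
    ∀ x, Pop lam U hU 0 x = x := expE_zero _

theorem Pop_one (lam : Fin d → ℝ) (U : Fin d → A) (hU : ∀ r, ‖U r‖ ≤ 1) (t : ℝ) :
    Pop lam U hU t 1 = 1 := by
  have hd : ∀ s, HasDerivAt (fun t => Pop lam U hU t 1) 0 s := fun s => by
    have := (Pop_deriv lam U hU s).clm_apply (hasDerivAt_const s (1 : Ball A →ᵇ ℝ))
    simpa [Lop_one] using this
  have := is_const_of_deriv_eq_zero (fun s => (hd s).differentiableAt) (fun s => (hd s).deriv) t 0
  simpa [Pop_zero] using this

theorem Sop_norm (u : A) (hu : ‖u‖ ≤ 1) : ‖Sop u hu‖ ≤ 1 := by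
  refine ContinuousLinearMap.opNorm_le_bound _ zero_le_one fun f => ?_
  rw [one_mul]
  rw [BoundedContinuousFunction.norm_le (norm_nonneg _)]
  intro x
  rw [Sop_apply]
  exact f.norm_coe_le_norm _

theorem sum_norm_aux {E : Type*} [NormedAddCommGroup E] [NormedSpace ℝ E]
    (lam : Fin d → ℝ) (hl : ∀ r, 0 ≤ lam r) (S : Fin d → (E →L[ℝ] E)) (hS : ∀ r, ‖S r‖ ≤ 1) :
    ‖∑ r, lam r • S r‖ ≤ ∑ r, lam r := by
  refine (norm_sum_le _ _).trans (Finset.sum_le_sum fun r _ => ?_)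
  rw [norm_smul, Real.norm_of_nonneg (hl r)]
  exact mul_le_of_le_one_right (hl r) (hS r)

theorem nontriv_aux : Nontrivial (Ball A →ᵇ ℝ) := ⟨0, 1, fun h => by
    have := congrArg (fun f : Ball A →ᵇ ℝ => f ballOne) h
    simp at this⟩

theorem Pop_norm (lam : Fin d → ℝ) (hl : ∀ r, 0 ≤ lam r) (U : Fin d → A) (hU : ∀ r, ‖U r‖ ≤ 1)
    (t : ℝ) (ht : 0 ≤ t) : ‖Pop lam U hU t‖ ≤ 1 := by
  have : Nontrivial (Ball A →ᵇ ℝ) := nontriv_aux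
  exact expE_norm (∑ r, lam r • Sop (U r) (hU r)) (∑ r, lam r) t
    (sum_norm_aux lam hl _ fun r => Sop_norm _ _) ht

theorem Pop_nonneg (lam : Fin d → ℝ) (hl : ∀ r, 0 ≤ lam r) (U : Fin d → A) (hU : ∀ r, ‖U r‖ ≤ 1)
    (t : ℝ) (ht : 0 ≤ t) (g : Ball A →ᵇ ℝ) (hg : ∀ x, 0 ≤ g x) (x : Ball A) :
    0 ≤ Pop lam U hU t g x := by
  set c := ‖g‖ / 2 with hc
  have h1 : ‖c • (1 : Ball A →ᵇ ℝ) - g‖ ≤ c := by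
    rw [BoundedContinuousFunction.norm_le (by positivity)]
    intro y
    have h2 := g.norm_coe_le_norm y
    rw [Real.norm_of_nonneg (hg y)] at h2
    have h3 := hg y
    simp only [BoundedContinuousFunction.coe_sub, Pi.sub_apply, BoundedContinuousFunction.coe_smul,
      BoundedContinuousFunction.coe_one, Pi.one_apply, smul_eq_mul, mul_one, Real.norm_eq_abs]
    rw [abs_le]; constructor <;> linarith
  have h2 : ‖Pop lam U hU t (c • (1 : Ball A →ᵇ ℝ) - g)‖ ≤ c := by
    refine ((Pop lam U hU t).le_opNorm _).trans ?_
    have := Pop_norm lam hl U hU t ht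
    calc _ ≤ 1 * c := by gcongr
      _ = c := one_mul _
  have h3 := ((Pop lam U hU t (c • (1 : Ball A →ᵇ ℝ) - g)).norm_coe_le_norm x).trans h2
  rw [map_sub, map_smul, Pop_one] at h3
  simp only [BoundedContinuousFunction.coe_sub, Pi.sub_apply, BoundedContinuousFunction.coe_smul,
      BoundedContinuousFunction.coe_one, Pi.one_apply, smul_eq_mul, mul_one, Real.norm_eq_abs] at h3
  have := (abs_le.1 h3).2
  linarith

/-- Iterated quadratic form. -/
def Qf (φ : A →L[ℝ] ℝ) (lam : Fin d → ℝ) (U : Fin d → A) : ℕ → A → ℝ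
  | 0, c => (φ c) ^ 2
  | m + 1, c => ∑ r, lam r * Qf φ lam U m ((U r - 1) * c)

def ell (lam : Fin d → ℝ) (U : Fin d → A) : A := ∑ r, lam r • (U r - 1)

theorem key_deriv (φ : A →L[ℝ] ℝ) (lam : Fin d → ℝ) (U : Fin d → A) (hU : ∀ r, ‖U r‖ ≤ 1)
    (t : ℝ) (c : A) (s : ℝ) :
    HasDerivAt (fun s => Pop lam U hU s
        ((Kmap φ (NormedSpace.exp ((t - s) • ell lam U) * c)) ^ 2) ballOne)
      (∑ r, lam r * Pop lam U hU s
        ((Kmap φ (NormedSpace.exp ((t - s) • ell lam U) * ((U r - 1) * c))) ^ 2) ballOne) s := by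
  have e1 : HasDerivAt (fun s : ℝ => NormedSpace.exp ((t - s) • ell lam U))
      (-(NormedSpace.exp ((t - s) • ell lam U) * ell lam U)) s := by
    have h1 := hasDerivAt_exp_smul_const (𝕂 := ℝ) (ell lam U) (t - s)
    have h2 : HasDerivAt (fun s : ℝ => t - s) (-1) s := by
      simpa using (hasDerivAt_id s).const_sub t
    have := h1.scomp s h2
    simp only [neg_smul, one_smul] at this
    exact this
  have e2 := (Kmap φ).hasFDerivAt.comp_hasDerivAt s (e1.mul_const c)
  have e3 := (Pop_deriv lam U hU s).clm_apply (e2.mul e2)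
  have e4 := (evalCLM ℝ (ballOne : Ball A)).hasFDerivAt.comp_hasDerivAt s e3
  refine (e4.congr_deriv ?_).congr_of_eventuallyEq (Filter.Eventually.of_forall fun s => ?_)
  swap
  · simp [pow_two]
  · symm
    have : ∀ r, lam r * Pop lam U hU s
        ((Kmap φ (NormedSpace.exp ((t - s) • ell lam U) * ((U r - 1) * c))) ^ 2) ballOne
        = evalCLM ℝ (ballOne : Ball A) (Pop lam U hU s (lam r •
        ((Kmap φ (NormedSpace.exp ((t - s) • ell lam U) * ((U r - 1) * c))) ^ 2))) := by
      intro r; simp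
    rw [Finset.sum_congr rfl fun r _ => this r, ← map_sum, ← map_sum]
    simp only [ContinuousLinearMap.comp_apply]
    rw [← map_add]
    congr 2
    ext x
    simp only [BoundedContinuousFunction.coe_add, BoundedContinuousFunction.coe_sum,
      Finset.sum_apply, Pi.add_apply, BoundedContinuousFunction.coe_smul, Function.comp,
      BoundedContinuousFunction.coe_mul, BoundedContinuousFunction.coe_pow, Pi.mul_apply,
      Pi.pow_apply, Lop_apply, Kmap_apply, mulMap, ContinuousMap.coe_mk, smul_eq_mul]
    set E := NormedSpace.exp ((t - s) • ell lam U)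
    have h5 : φ (-(E * ell lam U) * c * x.1) = - ∑ r, lam r * (φ (E * c * (U r * x.1)) - φ (E * c * x.1)) := by
      have : -(E * ell lam U) * c * x.1 = -∑ r, lam r • (E * c * (U r * x.1) - E * c * x.1) := by
        rw [ell, neg_mul, neg_mul, Finset.mul_sum, Finset.sum_mul, Finset.sum_mul]
        congr 1
        refine Finset.sum_congr rfl fun r _ => ?_
        rw [mul_smul_comm, smul_mul_assoc, smul_mul_assoc]
        congr 1; ring
      rw [this]; simp
    have h6 : ∀ r, φ (E * ((U r - 1) * c) * x.1) = φ (E * c * (U r * x.1)) - φ (E * c * x.1) := by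
      intro r; rw [← map_sub]; congr 1; ring
    rw [h5]
    simp only [h6]
    rw [neg_mul, mul_neg, Finset.sum_mul, Finset.mul_sum, ← Finset.sum_neg_distrib,
      ← Finset.sum_neg_distrib, ← Finset.sum_add_distrib, ← Finset.sum_add_distrib]
    refine Finset.sum_congr rfl fun r _ => ?_
    ring

theorem Qf_bound (φ : A →L[ℝ] ℝ) (lam : Fin d → ℝ) (hl : ∀ r, 0 ≤ lam r)
    (U : Fin d → A) (hU : ∀ r, ‖U r‖ ≤ 1) (m : ℕ) :
    ∀ (t : ℝ), 0 ≤ t → ∀ c : A,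
      t ^ m / (m.factorial : ℝ) * Qf φ lam U m (NormedSpace.exp (t • ell lam U) * c) ≤
        Pop lam U hU t ((Kmap φ c) ^ 2) ballOne := by
  induction m with
  | zero =>
    intro t ht c
    have hm : MonotoneOn (fun s => Pop lam U hU s
        ((Kmap φ (NormedSpace.exp ((t - s) • ell lam U) * c)) ^ 2) ballOne) (Set.Icc 0 t) := by
      refine monotoneOn_of_hasDerivWithinAt_nonneg (convex_Icc _ _)
        (fun s _ => (key_deriv φ lam U hU t c s).continuousAt.continuousWithinAt)
        (fun s _ => (key_deriv φ lam U hU t c s).hasDerivWithinAt) ?_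
      intro s hs
      rw [interior_Icc] at hs
      refine Finset.sum_nonneg fun r _ => mul_nonneg (hl r) ?_
      exact Pop_nonneg lam hl U hU s hs.1.le _ (fun x => by simpa using sq_nonneg _) _
    have := hm (Set.left_mem_Icc.2 ht) (Set.right_mem_Icc.2 ht) ht
    simp only [sub_zero, sub_self, zero_smul, NormedSpace.exp_zero, one_mul, Pop_zero] at this
    simpa [Qf, Kmap_apply, ballOne] using this
  | succ m ih =>
    intro t ht c
    set B := Qf φ lam U (m + 1) (NormedSpace.exp (t • ell lam U) * c) with hB
    have hpd : ∀ s : ℝ, HasDerivAt (fun s : ℝ => s ^ (m + 1) / ((m + 1).factorial : ℝ) * B)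
        (s ^ m / (m.factorial : ℝ) * B) s := by
      intro s
      have h1 := ((hasDerivAt_pow (m + 1) s).div_const ((m + 1).factorial : ℝ)).mul_const B
      refine h1.congr_deriv ?_
      rw [Nat.factorial_succ]
      have : (m.factorial : ℝ) ≠ 0 := by positivity
      push_cast
      field_simp
    have hdd := fun s => (key_deriv φ lam U hU t c s).sub (hpd s)
    have hm : MonotoneOn (fun s => Pop lam U hU s
        ((Kmap φ (NormedSpace.exp ((t - s) • ell lam U) * c)) ^ 2) ballOne -
        s ^ (m + 1) / ((m + 1).factorial : ℝ) * B) (Set.Icc 0 t) := by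
      refine monotoneOn_of_hasDerivWithinAt_nonneg (convex_Icc _ _)
        (fun s _ => (hdd s).continuousAt.continuousWithinAt)
        (fun s _ => (hdd s).hasDerivWithinAt) ?_
      intro s hs
      rw [interior_Icc] at hs
      rw [sub_nonneg, hB, Qf, Finset.mul_sum]
      refine Finset.sum_le_sum fun r _ => ?_
      have := ih s hs.1.le (NormedSpace.exp ((t - s) • ell lam U) * ((U r - 1) * c))
      rw [← mul_assoc (NormedSpace.exp (s • ell lam U)), ← exp_add_comm' (Commute.all _ _),
        ← add_smul, add_sub_cancel, mul_left_comm] at this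
      calc _ = lam r * (s ^ m / (m.factorial : ℝ) *
            Qf φ lam U m ((U r - 1) * (NormedSpace.exp (t • ell lam U) * c))) := by ring
        _ ≤ _ := mul_le_mul_of_nonneg_left this (hl r)
    have := hm (Set.left_mem_Icc.2 ht) (Set.right_mem_Icc.2 ht) ht
    simp only [sub_zero, sub_self, zero_smul, NormedSpace.exp_zero, one_mul, Pop_zero] at this
    have h0 : (0 : ℝ) ^ (m + 1) = 0 := by simp
    rw [h0, zero_div, zero_mul, sub_zero] at this
    have hsq : 0 ≤ ((Kmap φ (NormedSpace.exp (t • ell lam U) * c)) ^ 2) ballOne := by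
      simpa using sq_nonneg _
    linarith

theorem prod_sq_le {ι : Type*} (φ : A →L[ℝ] ℝ) (lam : Fin d → ℝ) (hl : ∀ r, 0 < lam r)
    (U : Fin d → A) (a : ι → Fin d → ℝ) (I : Finset ι) :
    ∀ c : A, (φ ((∏ i ∈ I, ∑ r, a i r • (U r - 1)) * c)) ^ 2 ≤
      (∏ i ∈ I, ∑ r, (a i r) ^ 2 / lam r) * Qf φ lam U I.card c := by
  induction I using Finset.induction_on with
  | empty => intro c; simp [Qf]
  | insert j I hj ih =>
    intro c
    rw [Finset.prod_insert hj, Finset.prod_insert hj, Finset.card_insert_of_notMem hj, Qf]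
    have h1 : φ ((∑ r, a j r • (U r - 1)) * (∏ i ∈ I, ∑ r, a i r • (U r - 1)) * c) =
        ∑ r, a j r * φ ((∏ i ∈ I, ∑ r, a i r • (U r - 1)) * ((U r - 1) * c)) := by
      rw [mul_assoc, Finset.sum_mul, map_sum]
      refine Finset.sum_congr rfl fun r _ => ?_
      rw [smul_mul_assoc, map_smul, smul_eq_mul, mul_left_comm]
    rw [h1]
    set Y := fun r => φ ((∏ i ∈ I, ∑ r, a i r • (U r - 1)) * ((U r - 1) * c)) with hY
    have h2 : (∑ r, a j r * Y r) ^ 2 ≤ (∑ r, (a j r) ^ 2 / lam r) * ∑ r, lam r * (Y r) ^ 2 := by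
      refine Finset.sum_sq_le_sum_mul_sum_of_sq_le_mul _ (fun r _ => ?_) (fun r _ => ?_) (fun r _ => ?_)
      · have := hl r; positivity
      · have := hl r; positivity
      · have := (hl r).ne'; field_simp; rfl
    refine h2.trans ?_
    rw [mul_assoc]
    have h3 : 0 ≤ ∑ r, (a j r) ^ 2 / lam r :=
      Finset.sum_nonneg fun r _ => div_nonneg (sq_nonneg _) (hl r).le
    refine mul_le_mul_of_nonneg_left ?_ h3
    rw [Finset.mul_sum]
    refine Finset.sum_le_sum fun r _ => ?_
    calc lam r * (Y r) ^ 2 ≤ lam r * _ := mul_le_mul_of_nonneg_left (ih _) (hl r).le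
      _ = _ := by ring

/-- Smoothness inequality. -/
theorem smooth {ι : Type*} (lam : Fin d → ℝ) (hl : ∀ r, 0 < lam r)
    (U : Fin d → A) (hU : ∀ r, ‖U r‖ ≤ 1) (a : ι → Fin d → ℝ) (I : Finset ι) :
    ‖(∏ i ∈ I, ∑ r, a i r • (U r - 1)) * NormedSpace.exp (ell lam U)‖ ≤
      Real.sqrt (I.card.factorial : ℝ) * ∏ i ∈ I, Real.sqrt (∑ r, (a i r) ^ 2 / lam r) := by
  obtain ⟨φ, hφ, hx⟩ := exists_dual_vector'' ℝ
    ((∏ i ∈ I, ∑ r, a i r • (U r - 1)) * NormedSpace.exp (ell lam U))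
  have hn : ∀ i, 0 ≤ ∑ r, (a i r) ^ 2 / lam r := fun i =>
      Finset.sum_nonneg fun r _ => div_nonneg (sq_nonneg _) (hl r).le
  have h1 := prod_sq_le φ lam hl U a I (NormedSpace.exp (ell lam U))
  have h2 := Qf_bound φ lam (fun r => (hl r).le) U hU I.card 1 zero_le_one 1
  rw [one_smul, mul_one, one_pow, one_div, inv_mul_le_iff₀ (by positivity)] at h2
  have h3 : Pop lam U hU 1 ((Kmap φ 1) ^ 2) ballOne ≤ 1 := by
    refine (le_abs_self _).trans ?_
    rw [← Real.norm_eq_abs]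
    refine (BoundedContinuousFunction.norm_coe_le_norm _ _).trans ?_
    refine ((Pop lam U hU 1).le_opNorm _).trans ?_
    have h4 := Pop_norm lam (fun r => (hl r).le) U hU 1 zero_le_one
    have h5 : ‖Kmap φ 1‖ ≤ 1 := (Kmap_norm_le φ 1).trans (by simpa using hφ)
    have h6 : ‖(Kmap φ 1) ^ 2‖ ≤ 1 := by
      rw [pow_two]
      refine (norm_mul_le _ _).trans ?_
      exact mul_le_one₀ h5 (norm_nonneg _) h5
    exact mul_le_one₀ h4 (norm_nonneg _) h6
  rw [hx] at h1
  rw [← Real.sqrt_prod _ fun i _ => hn i, ← Real.sqrt_mul (by positivity)]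
  apply Real.le_sqrt_of_sq_le
  refine h1.trans ?_
  rw [mul_comm]
  refine mul_le_mul_of_nonneg_right (h2.trans ?_) (Finset.prod_nonneg fun i _ => hn i)
  exact mul_le_of_le_one_right (by positivity) h3

end Smooth


section PartB

variable {A : Type*} [NormedCommRing A] [NormedAlgebra ℝ A] [CompleteSpace A] [NormOneClass A]

/-- remainder of the exponential after two terms -/
def expRem (x : A) : A := ∑' n : ℕ, (((n + 2).factorial : ℝ))⁻¹ • x ^ n

theorem real_rem_hasSum : HasSum (fun n : ℕ => (((n + 2).factorial : ℝ))⁻¹) (Real.exp 1 - 2) := by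
  have h := NormedSpace.exp_series_hasSum_exp' (𝕂 := ℝ) (1 : ℝ)
  rw [← Real.exp_eq_exp_ℝ] at h
  have h2 := (hasSum_nat_add_iff' 2).2 h
  simp only [one_pow, smul_eq_mul, mul_one, Finset.sum_range_succ, Finset.sum_range_zero,
    Nat.factorial_zero, Nat.factorial_one, Nat.cast_one, inv_one, zero_add] at h2
  have h3 : Real.exp 1 - (1 + 1) = Real.exp 1 - 2 := by norm_num
  rw [h3] at h2
  exact h2

theorem expRem_bound_aux (x : A) (hx : ‖x‖ ≤ 1) (n : ℕ) :
    ‖(((n + 2).factorial : ℝ))⁻¹ • x ^ n‖ ≤ (((n + 2).factorial : ℝ))⁻¹ := by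
  rw [norm_smul, norm_inv, Real.norm_natCast]
  refine mul_le_of_le_one_right (by positivity) ?_
  exact (norm_pow_le x n).trans (pow_le_one₀ (norm_nonneg _) hx)

theorem expRem_norm (x : A) (hx : ‖x‖ ≤ 1) : ‖expRem x‖ ≤ Real.exp 1 - 2 :=
  tsum_of_norm_bounded real_rem_hasSum (expRem_bound_aux x hx)

theorem exp_eq_rem (x : A) (hx : ‖x‖ ≤ 1) :
    NormedSpace.exp x = 1 + x + x ^ 2 * expRem x := by
  have h := NormedSpace.exp_series_hasSum_exp' (𝕂 := ℝ) x
  have h2 := (hasSum_nat_add_iff' 2).2 h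
  have hs : Summable (fun n : ℕ => (((n + 2).factorial : ℝ))⁻¹ • x ^ n) :=
    Summable.of_norm_bounded real_rem_hasSum.summable (expRem_bound_aux x hx)
  have h3 := hs.hasSum.mul_left (x ^ 2)
  have h4 : (fun n : ℕ => x ^ 2 * ((((n + 2).factorial : ℝ))⁻¹ • x ^ n)) =
      fun n : ℕ => (((n + 2).factorial : ℝ))⁻¹ • x ^ (n + 2) := by
    funext n
    rw [mul_smul_comm]; congr 1; ring
  rw [h4] at h3
  have h5 := h3.unique h2
  rw [expRem, h5]
  simp [Finset.sum_range_succ]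

theorem V_factor (R : A) (h1 : ‖1 + R‖ ≤ 1) (h2 : ‖R‖ ≤ 2) :
    ∃ W : A, ‖W‖ ≤ 0.86 ∧
      ((1 + R) * NormedSpace.exp (-R) - 1) * NormedSpace.exp ((1 / 2 : ℝ) • R) = R ^ 2 * W := by
  set y : A := (1 / 2 : ℝ) • R with hy
  have hR : R = y + y := by rw [hy, ← add_smul]; norm_num
  have hyn : ‖y‖ ≤ 1 := by
    rw [hy, norm_smul]; norm_num; linarith
  have hyn' : ‖-y‖ ≤ 1 := by rwa [norm_neg]
  refine ⟨(1 / 4 : ℝ) • ((1 + R) * expRem (-y) - expRem y - 2), ?_, ?_⟩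
  · have e1 := expRem_norm y hyn
    have e2 := expRem_norm (-y) hyn'
    have e3 := Real.exp_one_lt_d9
    have e4 : ‖(1 + R) * expRem (-y)‖ ≤ Real.exp 1 - 2 := by
      refine (norm_mul_le _ _).trans ?_
      calc _ ≤ 1 * ‖expRem (-y)‖ := by gcongr
        _ ≤ _ := by rw [one_mul]; exact e2
    have e5 : ‖(2 : A)‖ ≤ 2 := by
      have : (2 : A) = 1 + 1 := by norm_num
      rw [this]
      refine (norm_add_le _ _).trans ?_
      rw [norm_one]; norm_num
    rw [norm_smul]
    have e6 := norm_sub_le ((1 + R) * expRem (-y) - expRem y) 2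
    have e7 := norm_sub_le ((1 + R) * expRem (-y)) (expRem y)
    norm_num at *
    linarith
  · have h3 : NormedSpace.exp (-R) * NormedSpace.exp y = NormedSpace.exp (-y) := by
      rw [← exp_add_comm' (Commute.all _ _)]; congr 1; rw [hR]; ring
    rw [sub_mul, one_mul, mul_assoc, h3, exp_eq_rem y hyn, exp_eq_rem (-y) hyn', mul_smul_comm]
    have h4 : ∀ z w : A, (4:ℕ) • z = w → z = (1/4 : ℝ) • w := by
      intro z w h
      rw [← h, ← Nat.cast_smul_eq_nsmul ℝ, smul_smul]; norm_num
    apply h4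
    rw [hR, nsmul_eq_mul]
    push_cast
    ring

theorem prod_bound {ι : Type*} {d : ℕ} (lam : Fin d → ℝ) (hl : ∀ r, 0 < lam r)
    (U : Fin d → A) (hU : ∀ r, ‖U r‖ ≤ 1) (a : ι → Fin d → ℝ) (B : ι → A) (x y : ι → ℝ)
    (hx : ∀ i, Real.sqrt (∑ r, (a i r) ^ 2 / lam r) ≤ x i) (hB : ∀ i, ‖B i‖ ≤ y i)
    (I : Finset ι) (ρ : ℝ) (hρ0 : 0 ≤ ρ)
    (hρ : ∀ m ≤ I.card, Real.sqrt (m.factorial : ℝ) ≤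
      Real.sqrt (I.card.factorial : ℝ) * ρ ^ (I.card - m)) :
    ‖(∏ i ∈ I, ((∑ r, a i r • (U r - 1)) + B i)) * NormedSpace.exp (ell lam U)‖ ≤
      Real.sqrt (I.card.factorial : ℝ) * ∏ i ∈ I, (x i + ρ * y i) := by
  have hx0 : ∀ i, 0 ≤ x i := fun i => (Real.sqrt_nonneg _).trans (hx i)
  have hy0 : ∀ i, 0 ≤ y i := fun i => (norm_nonneg _).trans (hB i)
  rw [Finset.prod_add, Finset.prod_add, Finset.sum_mul, Finset.mul_sum]
  refine (norm_sum_le _ _).trans (Finset.sum_le_sum fun t ht => ?_)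
  rw [Finset.mem_powerset] at ht
  have hc := Finset.card_le_card ht
  have h1 := smooth lam hl U hU a t
  have h2 : ‖∏ i ∈ I \ t, B i‖ ≤ ∏ i ∈ I \ t, y i :=
    (Finset.norm_prod_le _ _).trans (Finset.prod_le_prod (fun i _ => norm_nonneg _) fun i _ => hB i)
  have h3 : ∏ i ∈ t, Real.sqrt (∑ r, (a i r) ^ 2 / lam r) ≤ ∏ i ∈ t, x i :=
    Finset.prod_le_prod (fun i _ => Real.sqrt_nonneg _) fun i _ => hx i
  have hpx : 0 ≤ ∏ i ∈ t, x i := Finset.prod_nonneg fun i _ => hx0 i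
  have hpy : 0 ≤ ∏ i ∈ I \ t, y i := Finset.prod_nonneg fun i _ => hy0 i
  rw [mul_right_comm, Finset.prod_mul_distrib, Finset.prod_const, Finset.card_sdiff_of_subset ht]
  calc _ ≤ ‖(∏ i ∈ t, ∑ r, a i r • (U r - 1)) * NormedSpace.exp (ell lam U)‖ *
        ‖∏ i ∈ I \ t, B i‖ := norm_mul_le _ _
    _ ≤ (Real.sqrt (t.card.factorial : ℝ) * ∏ i ∈ t, x i) * ∏ i ∈ I \ t, y i := by
        gcongr
        exact h1.trans (by gcongr)
    _ ≤ (Real.sqrt (I.card.factorial : ℝ) * ρ ^ (I.card - t.card) * ∏ i ∈ t, x i) *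
        ∏ i ∈ I \ t, y i := by
        gcongr
        exact hρ _ hc
    _ = _ := by ring

theorem prod_sq_bound {ι : Type*} {d : ℕ} (lam : Fin d → ℝ) (hl : ∀ r, 0 < lam r)
    (U : Fin d → A) (hU : ∀ r, ‖U r‖ ≤ 1) (a : ι → Fin d → ℝ) (B : ι → A) (x y : ι → ℝ)
    (hx : ∀ i, Real.sqrt (∑ r, (a i r) ^ 2 / lam r) ≤ x i) (hB : ∀ i, ‖B i‖ ≤ y i)
    (J : Finset ι) (ρ : ℝ) (hρ0 : 0 ≤ ρ)
    (hρ : ∀ m ≤ 2 * J.card, Real.sqrt (m.factorial : ℝ) ≤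
      Real.sqrt ((2 * J.card).factorial : ℝ) * ρ ^ (2 * J.card - m)) :
    ‖(∏ i ∈ J, ((∑ r, a i r • (U r - 1)) + B i) ^ 2) * NormedSpace.exp (ell lam U)‖ ≤
      Real.sqrt ((2 * J.card).factorial : ℝ) * ∏ i ∈ J, (x i + ρ * y i) ^ 2 := by
  have hc : (J ×ˢ (Finset.univ : Finset Bool)).card = 2 * J.card := by
    rw [Finset.card_product]; simp [mul_comm]
  have := prod_bound lam hl U hU (fun z : ι × Bool => a z.1) (fun z => B z.1) (fun z => x z.1)
    (fun z => y z.1) (fun z => hx z.1) (fun z => hB z.1) (J ×ˢ (Finset.univ : Finset Bool)) ρ hρ0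
    (by rw [hc]; exact hρ)
  rw [hc, Finset.prod_product, Finset.prod_product] at this
  simpa [pow_two] using this

theorem exp_sum_comm {ι : Type*} (s : Finset ι) (f : ι → A) :
    NormedSpace.exp (∑ i ∈ s, f i) = ∏ i ∈ s, NormedSpace.exp (f i) := by
  induction s using Finset.induction_on with
  | empty => simp
  | insert j s hj ih =>
    rw [Finset.sum_insert hj, Finset.prod_insert hj, exp_add_comm' (Commute.all _ _), ih]

theorem bern_aux (x S : ℝ) (hx : 0 ≤ x) (hS : 0 ≤ S) (k : ℕ) :
    S ^ (k + 1) + (k + 1) * x * S ^ k ≤ (x + S) ^ (k + 1) := by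
  induction k with
  | zero => simp; linarith
  | succ k ih =>
    have h1 := mul_le_mul_of_nonneg_right ih (add_nonneg hx hS)
    have h2 : 0 ≤ ((k : ℝ) + 1) * x ^ 2 * S ^ k := by positivity
    rw [pow_succ (x + S) (k + 1)]
    refine le_trans ?_ h1
    push_cast
    ring_nf at h2 ⊢
    linarith

theorem esymm_bound {ι : Type*} (s : Finset ι) (x : ι → ℝ) (hx : ∀ i, 0 ≤ x i) :
    ∀ k : ℕ, (k.factorial : ℝ) * ∑ J ∈ s.powersetCard k, ∏ j ∈ J, x j ≤ (∑ j ∈ s, x j) ^ k := by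
  induction s using Finset.induction_on with
  | empty =>
    intro k
    cases k with
    | zero => simp
    | succ k => rw [Finset.powersetCard_eq_empty.2 (by simp)]; simp
  | insert j s hj ih =>
    intro k
    cases k with
    | zero => simp
    | succ k =>
      have hS : 0 ≤ ∑ i ∈ s, x i := Finset.sum_nonneg fun i _ => hx i
      rw [Finset.powersetCard_succ_insert hj, Finset.sum_union, Finset.sum_image,
        Finset.sum_insert hj]
      · have h1 := ih (k + 1)
        have h2 := ih k
        have h3 : ∑ J ∈ s.powersetCard k, ∏ i ∈ insert j J, x i =
            x j * ∑ J ∈ s.powersetCard k, ∏ i ∈ J, x i := by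
          rw [Finset.mul_sum]
          refine Finset.sum_congr rfl fun J hJ => ?_
          rw [Finset.prod_insert]
          exact fun h => hj ((Finset.mem_powersetCard.1 hJ).1 h)
        rw [h3, mul_add, Nat.factorial_succ]
        have h4 : (∑ i ∈ s, x i) ^ (k + 1) + (k + 1) * x j * (∑ i ∈ s, x i) ^ k ≤
            (x j + ∑ i ∈ s, x i) ^ (k + 1) := by
          exact bern_aux _ _ (hx j) hS k
        have h5 := mul_le_mul_of_nonneg_left h2 (mul_nonneg (by positivity : (0:ℝ) ≤ k + 1) (hx j))
        rw [Nat.factorial_succ] at h1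
        push_cast at *
        linarith
      · intro J1 h1 J2 h2 h
        have n1 : j ∉ J1 := fun hh => hj ((Finset.mem_powersetCard.1 h1).1 hh)
        have n2 : j ∉ J2 := fun hh => hj ((Finset.mem_powersetCard.1 h2).1 hh)
        rw [← Finset.erase_insert n1, ← Finset.erase_insert n2, h]
      · rw [Finset.disjoint_left]
        intro J h1 h2
        obtain ⟨J', h3, rfl⟩ := Finset.mem_image.1 h2
        exact hj ((Finset.mem_powersetCard.1 h1).1 (Finset.mem_insert_self _ _))

end PartB


section PartB2

variable {A : Type*} [NormedCommRing A] [NormedAlgebra ℝ A] [CompleteSpace A] [NormOneClass A]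

structure Hyp {n d : ℕ} (p : Fin n → ℝ) (q : Fin n → Fin d → ℝ) (lam : Fin d → ℝ)
    (U : Fin d → A) : Prop where
  hp : ∀ j, p j ∈ Set.Icc (0:ℝ) 1
  hq : ∀ j r, q j r ∈ Set.Icc (0:ℝ) 1
  hq1 : ∀ j, ∑ r, q j r = 1
  hlam : ∀ r, lam r = ∑ j, p j * q j r
  hpos : ∀ r, 0 < lam r
  hU : ∀ r, ‖U r‖ ≤ 1

def Rj {n d : ℕ} (p : Fin n → ℝ) (q : Fin n → Fin d → ℝ) (U : Fin d → A) (j : Fin n) : A :=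
  p j • (∑ r, q j r • U r - 1)

def Vj {n d : ℕ} (p : Fin n → ℝ) (q : Fin n → Fin d → ℝ) (U : Fin d → A) (j : Fin n) : A :=
  (1 + Rj p q U j) * NormedSpace.exp (-(Rj p q U j)) - 1

def betaj {n d : ℕ} (q : Fin n → Fin d → ℝ) (lam : Fin d → ℝ) (j : Fin n) : ℝ :=
  ∑ r, q j r * min (q j r / lam r) 1

variable {n d : ℕ} {p : Fin n → ℝ} {q : Fin n → Fin d → ℝ} {lam : Fin d → ℝ} {U : Fin d → A}

theorem Hyp.normQ (h : Hyp p q lam U) (j : Fin n) : ‖∑ r, q j r • U r‖ ≤ 1 := by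
  refine (norm_sum_le _ _).trans ?_
  rw [← h.hq1 j]
  refine Finset.sum_le_sum fun r _ => ?_
  rw [norm_smul, Real.norm_of_nonneg (h.hq j r).1]
  exact mul_le_of_le_one_right (h.hq j r).1 (h.hU r)

theorem Rj_eq (h : Hyp p q lam U) (j : Fin n) : Rj p q U j = p j • ∑ r, q j r • (U r - 1) := by
  rw [Rj]
  congr 1
  simp only [smul_sub, Finset.sum_sub_distrib]
  rw [← Finset.sum_smul, h.hq1 j, one_smul]

theorem normF (h : Hyp p q lam U) (j : Fin n) : ‖1 + Rj p q U j‖ ≤ 1 := by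
  have : 1 + Rj p q U j = (1 - p j) • (1 : A) + p j • ∑ r, q j r • U r := by
    rw [Rj, smul_sub, sub_smul, one_smul]; abel
  rw [this]
  refine (norm_add_le _ _).trans ?_
  rw [norm_smul, norm_smul, norm_one, Real.norm_of_nonneg (h.hp j).1,
    Real.norm_of_nonneg (sub_nonneg.2 (h.hp j).2)]
  have := mul_le_of_le_one_right (h.hp j).1 (h.normQ j)
  linarith

theorem normR (h : Hyp p q lam U) (j : Fin n) : ‖Rj p q U j‖ ≤ 2 := by
  rw [Rj, norm_smul, Real.norm_of_nonneg (h.hp j).1]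
  have h1 := norm_sub_le (∑ r, q j r • U r) 1
  rw [norm_one] at h1
  have h2 := h.normQ j
  calc _ ≤ 1 * ‖∑ r, q j r • U r - 1‖ := by
        gcongr
        exact (h.hp j).2
    _ ≤ 2 := by linarith

theorem norm_expR (h : Hyp p q lam U) (j : Fin n) (c : ℝ) (hc : 0 ≤ c) :
    ‖NormedSpace.exp (c • Rj p q U j)‖ ≤ 1 := by
  rw [Rj, smul_sub, smul_sub, smul_smul, smul_smul]
  apply norm_exp_sub_le_one
  have hp := (h.hp j).1
  rw [norm_smul, Real.norm_of_nonneg (by positivity)]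
  exact mul_le_of_le_one_right (by positivity) (h.normQ j)

theorem ell_eq (h : Hyp p q lam U) : ell lam U = ∑ j, Rj p q U j := by
  simp only [Rj_eq h, ell, h.hlam, Finset.sum_smul, Finset.smul_sum, smul_smul]
  rw [Finset.sum_comm]

theorem beta_nonneg (h : Hyp p q lam U) (j : Fin n) : 0 ≤ betaj q lam j :=
  Finset.sum_nonneg fun r _ => mul_nonneg (h.hq j r).1
    (le_min (div_nonneg (h.hq j r).1 (h.hpos r).le) zero_le_one)

theorem real_ineq (a b ρ : ℝ) (ha : 0 ≤ a) (hb : 0 ≤ b) (hab : a + b ≤ 1) (hρ : 0 < ρ) :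
    Real.sqrt (2 * a) + ρ * (2 * b) ≤ (2 * ρ + 1 / (4 * ρ)) * Real.sqrt (a + b) := by
  set y := Real.sqrt (a + b) with hy
  have hy0 : 0 ≤ y := Real.sqrt_nonneg _
  have hy2 : y ^ 2 = a + b := Real.sq_sqrt (by positivity)
  have hy1 : y ≤ 1 := by rw [hy]; exact Real.sqrt_le_one.2 hab
  set x := Real.sqrt (2 * a) with hx
  have hx0 : 0 ≤ x := Real.sqrt_nonneg _
  have hx2 : x ^ 2 = 2 * a := Real.sq_sqrt (by positivity)
  rcases hy0.eq_or_lt with h0 | h0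
  · rw [← h0] at hy2 ⊢
    have ha0 : a = 0 := by nlinarith
    have hb0 : b = 0 := by nlinarith
    rw [hx, ha0, hb0]; simp
  have h1 : y * (2 * b) ≤ 2 * y ^ 2 - x ^ 2 := by
    have : 2 * b = 2 * y ^ 2 - x ^ 2 := by rw [hx2, hy2]; ring
    have hb' : 0 ≤ 2 * b := by positivity
    nlinarith
  have h2 : 0 ≤ (2 * ρ * x - y) ^ 2 := sq_nonneg _
  have h3 : 4 * ρ * y * (x + ρ * (2 * b)) ≤ 4 * ρ * y * ((2 * ρ + 1 / (4 * ρ)) * y) := by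
    have e : 4 * ρ * y * ((2 * ρ + 1 / (4 * ρ)) * y) = 8 * ρ ^ 2 * y ^ 2 + y ^ 2 := by
      field_simp; ring
    rw [e]
    have := mul_le_mul_of_nonneg_left h1 (by positivity : 0 ≤ 4 * ρ ^ 2)
    nlinarith
  exact le_of_mul_le_mul_left h3 (by positivity)

theorem prodD_bound (h : Hyp p q lam U) (J : Finset (Fin n)) (ρ : ℝ) (hρ0 : 0 < ρ)
    (hρ : ∀ m ≤ 2 * J.card, Real.sqrt (m.factorial : ℝ) ≤
      Real.sqrt ((2 * J.card).factorial : ℝ) * ρ ^ (2 * J.card - m)) :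
    ‖(∏ j ∈ J, (∑ r, q j r • (U r - 1)) ^ 2) * NormedSpace.exp ((1 / 2 : ℝ) • ell lam U)‖ ≤
      Real.sqrt ((2 * J.card).factorial : ℝ) *
        ∏ j ∈ J, ((2 * ρ + 1 / (4 * ρ)) ^ 2 * betaj q lam j) := by
  have e1 : (1 / 2 : ℝ) • ell lam U = ell (fun r => lam r / 2) U := by
    rw [ell, ell, Finset.smul_sum]
    refine Finset.sum_congr rfl fun r _ => ?_
    rw [smul_smul]; congr 1; ring
  set a : Fin n → Fin d → ℝ := fun j r => if q j r ≤ lam r then q j r else 0 with ha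
  set b : Fin n → Fin d → ℝ := fun j r => if q j r ≤ lam r then 0 else q j r with hb
  set aa : Fin n → ℝ := fun j => ∑ r, (a j r) ^ 2 / lam r with haa
  set bb : Fin n → ℝ := fun j => ∑ r, b j r with hbb
  have hb0 : ∀ j r, 0 ≤ b j r := by
    intro j r; simp only [hb]; split_ifs
    · exact le_rfl
    · exact (h.hq j r).1
  have haa0 : ∀ j, 0 ≤ aa j := fun j =>
    Finset.sum_nonneg fun r _ => div_nonneg (sq_nonneg _) (h.hpos r).le
  have hbb0 : ∀ j, 0 ≤ bb j := fun j => Finset.sum_nonneg fun r _ => hb0 j r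
  have hab : ∀ j, aa j + bb j = betaj q lam j := by
    intro j
    rw [haa, hbb, betaj, ← Finset.sum_add_distrib]
    refine Finset.sum_congr rfl fun r _ => ?_
    have hpos := h.hpos r
    simp only [ha, hb]
    split_ifs with hc
    · rw [min_eq_left ((div_le_one hpos).2 hc)]; ring
    · rw [min_eq_right ((one_le_div hpos).2 (not_le.1 hc).le)]; simp
  have hbeta1 : ∀ j, betaj q lam j ≤ 1 := by
    intro j
    rw [betaj]
    refine le_trans (Finset.sum_le_sum fun r _ => ?_) (h.hq1 j).le
    exact mul_le_of_le_one_right (h.hq j r).1 (min_le_right _ _)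
  have key := prod_sq_bound (fun r => lam r / 2) (fun r => half_pos (h.hpos r)) U h.hU a
    (fun j => ∑ r, b j r • (U r - 1)) (fun j => Real.sqrt (2 * aa j)) (fun j => 2 * bb j)
    (by
      intro j
      apply Real.sqrt_le_sqrt
      rw [haa, Finset.mul_sum]
      refine le_of_eq (Finset.sum_congr rfl fun r _ => ?_)
      have := (h.hpos r).ne'
      field_simp)
    (by
      intro j
      refine (norm_sum_le _ _).trans ?_
      rw [hbb, Finset.mul_sum]
      refine Finset.sum_le_sum fun r _ => ?_
      rw [norm_smul, Real.norm_of_nonneg (hb0 j r), mul_comm]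
      refine mul_le_mul_of_nonneg_right ?_ (hb0 j r)
      have h1 := norm_sub_le (U r) 1
      have h2 := h.hU r
      rw [norm_one] at h1
      linarith)
    J ρ hρ0.le hρ
  have e2 : ∀ j, (∑ r, a j r • (U r - 1)) + ∑ r, b j r • (U r - 1) = ∑ r, q j r • (U r - 1) := by
    intro j
    rw [← Finset.sum_add_distrib]
    refine Finset.sum_congr rfl fun r _ => ?_
    rw [← add_smul]; congr 1
    simp only [ha, hb]; split_ifs <;> simp
  simp only [e2] at key
  rw [e1]
  refine key.trans ?_
  refine mul_le_mul_of_nonneg_left ?_ (Real.sqrt_nonneg _)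
  refine Finset.prod_le_prod (fun j _ => sq_nonneg _) fun j _ => ?_
  have h1 := real_ineq (aa j) (bb j) ρ (haa0 j) (hbb0 j) (by rw [hab]; exact hbeta1 j) hρ0
  rw [hab] at h1
  have h2 : 0 ≤ Real.sqrt (2 * aa j) + ρ * (2 * bb j) := by
    have := hbb0 j
    positivity
  calc _ ≤ ((2 * ρ + 1 / (4 * ρ)) * Real.sqrt (betaj q lam j)) ^ 2 := by gcongr
    _ = _ := by rw [mul_pow, Real.sq_sqrt (beta_nonneg h j)]

theorem prodV_bound (h : Hyp p q lam U) (J : Finset (Fin n)) (ρ : ℝ) (hρ0 : 0 < ρ)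
    (hρ : ∀ m ≤ 2 * J.card, Real.sqrt (m.factorial : ℝ) ≤
      Real.sqrt ((2 * J.card).factorial : ℝ) * ρ ^ (2 * J.card - m)) :
    ‖(∏ j ∈ J, Vj p q U j) * NormedSpace.exp (ell lam U)‖ ≤
      Real.sqrt ((2 * J.card).factorial : ℝ) *
        ((2 * ρ + 1 / (4 * ρ)) ^ 2 * 0.86) ^ J.card * ∏ j ∈ J, (p j ^ 2 * betaj q lam j) := by
  choose W hW1 hW2 using fun j => V_factor (Rj p q U j) (normF h j) (normR h j)
  have e1 : NormedSpace.exp (ell lam U) = (∏ j ∈ J, NormedSpace.exp ((1 / 2 : ℝ) • Rj p q U j)) *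
      (∏ j ∈ Jᶜ, NormedSpace.exp ((1 / 2 : ℝ) • Rj p q U j)) *
      NormedSpace.exp ((1 / 2 : ℝ) • ell lam U) := by
    rw [Finset.prod_mul_prod_compl, ← exp_sum_comm, ← Finset.smul_sum, ← ell_eq h,
      ← exp_add_comm' (Commute.all _ _), ← add_smul]
    norm_num
  have e2 : ∏ j ∈ J, Vj p q U j * NormedSpace.exp ((1 / 2 : ℝ) • Rj p q U j) =
      (∏ j ∈ J, p j ^ 2) • ((∏ j ∈ J, (∑ r, q j r • (U r - 1)) ^ 2) * ∏ j ∈ J, W j) := by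
    rw [Algebra.smul_def, map_prod, ← Finset.prod_mul_distrib, ← Finset.prod_mul_distrib]
    refine Finset.prod_congr rfl fun j _ => ?_
    rw [Vj, hW2, Rj_eq h, ← Algebra.smul_def, smul_pow, smul_mul_assoc]
  have e3 : (∏ j ∈ J, Vj p q U j) * NormedSpace.exp (ell lam U) =
      (∏ j ∈ J, p j ^ 2) • (((∏ j ∈ J, (∑ r, q j r • (U r - 1)) ^ 2) *
        NormedSpace.exp ((1 / 2 : ℝ) • ell lam U)) * ((∏ j ∈ J, W j) *
        (∏ j ∈ Jᶜ, NormedSpace.exp ((1 / 2 : ℝ) • Rj p q U j)))) := by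
    rw [e1, ← mul_assoc, ← mul_assoc, ← Finset.prod_mul_distrib, e2, smul_mul_assoc, smul_mul_assoc]
    congr 1; ring
  have n1 : ‖∏ j ∈ J, W j‖ ≤ 0.86 ^ J.card := by
    refine (Finset.norm_prod_le _ _).trans ?_
    refine (Finset.prod_le_prod (fun j _ => norm_nonneg _) fun j _ => hW1 j).trans ?_
    rw [Finset.prod_const]
  have n2 : ‖∏ j ∈ Jᶜ, NormedSpace.exp ((1 / 2 : ℝ) • Rj p q U j)‖ ≤ 1 := by
    refine (Finset.norm_prod_le _ _).trans ?_
    exact Finset.prod_le_one (fun j _ => norm_nonneg _) fun j _ => norm_expR h j _ (by norm_num)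
  have n3 := prodD_bound h J ρ hρ0 hρ
  have hbp : 0 ≤ ∏ j ∈ J, ((2 * ρ + 1 / (4 * ρ)) ^ 2 * betaj q lam j) :=
    Finset.prod_nonneg fun j _ => mul_nonneg (sq_nonneg _) (beta_nonneg h j)
  have hpp : 0 ≤ ∏ j ∈ J, p j ^ 2 := Finset.prod_nonneg fun j _ => sq_nonneg _
  rw [e3, norm_smul, Real.norm_of_nonneg hpp]
  calc _ ≤ (∏ j ∈ J, p j ^ 2) * ((Real.sqrt ((2 * J.card).factorial : ℝ) *
        ∏ j ∈ J, ((2 * ρ + 1 / (4 * ρ)) ^ 2 * betaj q lam j)) * (0.86 ^ J.card * 1)) := by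
        refine mul_le_mul_of_nonneg_left ?_ hpp
        refine (norm_mul_le _ _).trans ?_
        refine mul_le_mul n3 ?_ (norm_nonneg _) (by positivity)
        refine (norm_mul_le _ _).trans ?_
        exact mul_le_mul n1 n2 (norm_nonneg _) (by positivity)
    _ = _ := by
        rw [Finset.prod_mul_distrib, Finset.prod_mul_distrib, Finset.prod_const, mul_pow]
        ring

def Hk (p : Fin n → ℝ) (q : Fin n → Fin d → ℝ) (lam : Fin d → ℝ) (U : Fin d → A) (k : ℕ) : A :=
  (∑ J ∈ Finset.powersetCard k Finset.univ, ∏ j ∈ J, Vj p q U j) * NormedSpace.exp (ell lam U)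

theorem Hk_bound (h : Hyp p q lam U) (k : ℕ) (ρ : ℝ) (hρ0 : 0 < ρ)
    (hρ : ∀ m ≤ 2 * k, Real.sqrt (m.factorial : ℝ) ≤
      Real.sqrt ((2 * k).factorial : ℝ) * ρ ^ (2 * k - m)) :
    ‖Hk p q lam U k‖ ≤ Real.sqrt ((2 * k).factorial : ℝ) / (k.factorial : ℝ) *
      ((2 * ρ + 1 / (4 * ρ)) ^ 2 * 0.86) ^ k * (∑ j, p j ^ 2 * betaj q lam j) ^ k := by
  rw [Hk, Finset.sum_mul]
  refine (norm_sum_le _ _).trans ?_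
  have h1 : ∀ J ∈ Finset.powersetCard k (Finset.univ : Finset (Fin n)),
      ‖(∏ j ∈ J, Vj p q U j) * NormedSpace.exp (ell lam U)‖ ≤
      Real.sqrt ((2 * k).factorial : ℝ) *
        ((2 * ρ + 1 / (4 * ρ)) ^ 2 * 0.86) ^ k * ∏ j ∈ J, (p j ^ 2 * betaj q lam j) := by
    intro J hJ
    have hk := (Finset.mem_powersetCard.1 hJ).2
    subst hk
    exact prodV_bound h J ρ hρ0 hρ
  refine (Finset.sum_le_sum h1).trans ?_
  rw [← Finset.mul_sum]
  have h2 := esymm_bound Finset.univ (fun j => p j ^ 2 * betaj q lam j)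
    (fun j => mul_nonneg (sq_nonneg _) (beta_nonneg h j)) k
  rw [← le_div_iff₀' (by positivity)] at h2
  calc _ ≤ Real.sqrt ((2 * k).factorial : ℝ) * ((2 * ρ + 1 / (4 * ρ)) ^ 2 * 0.86) ^ k *
        ((∑ j, p j ^ 2 * betaj q lam j) ^ k / (k.factorial : ℝ)) := by
        gcongr
    _ = _ := by ring

end PartB2


section PartB3

theorem sqrt_fact_of (m N : ℕ) (ρ : ℝ) (hρ : 0 ≤ ρ)
    (h : (m.factorial : ℝ) ≤ N.factorial * (ρ ^ 2) ^ (N - m)) :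
    Real.sqrt (m.factorial : ℝ) ≤ Real.sqrt (N.factorial : ℝ) * ρ ^ (N - m) := by
  rw [Real.sqrt_le_left (by positivity), mul_pow, Real.sq_sqrt (by positivity), ← pow_mul,
    mul_comm (N - m), pow_mul]
  exact h

theorem fact_big (N : ℕ) (hN : 6 ≤ N) : ∀ m ≤ N,
    (m.factorial : ℝ) ≤ N.factorial * ((0.58 : ℝ) ^ 2) ^ (N - m) := by
  induction N, hN using Nat.le_induction with
  | base =>
    intro m hm
    interval_cases m <;> norm_num [Nat.factorial]
  | succ N hN ih =>
    intro m hm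
    rcases Nat.lt_or_ge N m with h | h
    · have : m = N + 1 := by omega
      subst this; simp
    · refine (ih m h).trans ?_
      rw [show N + 1 - m = (N - m) + 1 by omega, pow_succ ((0.58 : ℝ) ^ 2), Nat.factorial_succ]
      push_cast
      have h6 : (6 : ℝ) ≤ N := by exact_mod_cast hN
      have h7 : 0 ≤ (N.factorial : ℝ) * ((0.58 : ℝ) ^ 2) ^ (N - m) := by positivity
      have h8 : (1 : ℝ) ≤ (N + 1) * 0.58 ^ 2 := by nlinarith
      calc (N.factorial : ℝ) * ((0.58 : ℝ) ^ 2) ^ (N - m)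
          = (N.factorial : ℝ) * ((0.58 : ℝ) ^ 2) ^ (N - m) * 1 := by ring
        _ ≤ (N.factorial : ℝ) * ((0.58 : ℝ) ^ 2) ^ (N - m) * ((N + 1) * 0.58 ^ 2) :=
            mul_le_mul_of_nonneg_left h8 h7
        _ = _ := by ring

theorem central_bound (k : ℕ) (hk : 3 ≤ k) : (k.centralBinom : ℝ) ≤ 20 / 64 * 4 ^ k := by
  induction k, hk using Nat.le_induction with
  | base => norm_num [Nat.centralBinom, Nat.choose]
  | succ k hk ih =>
    have h1 : ((k : ℝ) + 1) * (k + 1).centralBinom = 2 * (2 * k + 1) * k.centralBinom := by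
      exact_mod_cast Nat.succ_mul_centralBinom_succ k
    have h2 : ((k : ℝ) + 1) * (k + 1).centralBinom ≤ ((k : ℝ) + 1) * (20 / 64 * 4 ^ (k + 1)) := by
      rw [h1, pow_succ]
      have : (0 : ℝ) ≤ 4 ^ k := by positivity
      have hk0 : (0 : ℝ) ≤ k := by positivity
      nlinarith
    exact le_of_mul_le_mul_left h2 (by positivity)

theorem sqrt_ratio (k : ℕ) (hk : 3 ≤ k) :
    Real.sqrt ((2 * k).factorial : ℝ) / (k.factorial : ℝ) ≤ 0.5591 * 2 ^ k := by
  rw [div_le_iff₀ (by positivity), Real.sqrt_le_left (by positivity)]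
  have h1 : ((2 * k).factorial : ℝ) = k.centralBinom * (k.factorial : ℝ) ^ 2 := by
    have := Nat.choose_mul_factorial_mul_factorial (n := 2 * k) (k := k) (by omega)
    rw [← Nat.centralBinom_eq_two_mul_choose, show 2 * k - k = k by omega] at this
    rw [← this]; push_cast; ring
  rw [h1, mul_pow, mul_pow]
  refine mul_le_mul_of_nonneg_right ?_ (sq_nonneg _)
  refine (central_bound k hk).trans ?_
  rw [← pow_mul, mul_comm k 2, pow_mul]
  have : (0 : ℝ) ≤ 4 ^ k := by positivity
  norm_num

variable {A : Type*} [NormedCommRing A] [NormedAlgebra ℝ A] [CompleteSpace A] [NormOneClass A]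
variable {n d : ℕ} {p : Fin n → ℝ} {q : Fin n → Fin d → ℝ} {lam : Fin d → ℝ} {U : Fin d → A}

theorem betaTot_nonneg (h : Hyp p q lam U) : 0 ≤ ∑ j, p j ^ 2 * betaj q lam j :=
  Finset.sum_nonneg fun j _ => mul_nonneg (sq_nonneg _) (beta_nonneg h j)

theorem H1_bound (h : Hyp p q lam U) :
    ‖Hk p q lam U 1‖ ≤ 4.84 * (∑ j, p j ^ 2 * betaj q lam j) := by
  have h1 := Hk_bound h 1 0.85 (by norm_num) (fun m hm => sqrt_fact_of _ _ _ (by norm_num) (by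
    have hm' : m ≤ 2 := by omega
    interval_cases m <;> norm_num [Nat.factorial]))
  refine h1.trans ?_
  have hs : Real.sqrt ((2 * 1).factorial : ℝ) ≤ 1.4143 := by
    rw [Real.sqrt_le_left (by norm_num)]; norm_num [Nat.factorial]
  rw [pow_one (∑ j, p j ^ 2 * betaj q lam j)]
  refine mul_le_mul_of_nonneg_right ?_ (betaTot_nonneg h)
  rw [Nat.factorial_one, Nat.cast_one, div_one, pow_one]
  norm_num at hs ⊢
  linarith

theorem H2_bound (h : Hyp p q lam U) :
    ‖Hk p q lam U 2‖ ≤ 16.15 * (∑ j, p j ^ 2 * betaj q lam j) ^ 2 := by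
  have h1 := Hk_bound h 2 0.68 (by norm_num) (fun m hm => sqrt_fact_of _ _ _ (by norm_num) (by
    have hm' : m ≤ 4 := by omega
    interval_cases m <;> norm_num [Nat.factorial]))
  refine h1.trans ?_
  have hs : Real.sqrt ((2 * 2).factorial : ℝ) ≤ 4.899 := by
    rw [Real.sqrt_le_left (by norm_num)]; norm_num [Nat.factorial]
  refine mul_le_mul_of_nonneg_right ?_ (by have := betaTot_nonneg h; positivity)
  rw [show ((Nat.factorial 2 : ℕ) : ℝ) = 2 by norm_num [Nat.factorial]]
  set s := Real.sqrt ((2 * 2).factorial : ℝ)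
  norm_num at hs ⊢
  linarith

theorem H3_bound (h : Hyp p q lam U) (k : ℕ) (hk : 3 ≤ k) :
    ‖Hk p q lam U k‖ ≤ 0.5591 * (4.355 * (∑ j, p j ^ 2 * betaj q lam j)) ^ k := by
  have h1 := Hk_bound h k 0.58 (by norm_num) (fun m hm => sqrt_fact_of _ _ _ (by norm_num)
    (fact_big _ (by omega) m hm))
  refine h1.trans ?_
  rw [mul_pow 4.355, ← mul_assoc]
  refine mul_le_mul_of_nonneg_right ?_ (by have := betaTot_nonneg h; positivity)
  calc _ ≤ (0.5591 * 2 ^ k : ℝ) * ((2 * 0.58 + 1 / (4 * 0.58)) ^ 2 * 0.86 : ℝ) ^ k := by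
        refine mul_le_mul_of_nonneg_right (sqrt_ratio k hk) (by positivity)
    _ = (0.5591 : ℝ) * (2 * ((2 * 0.58 + 1 / (4 * 0.58)) ^ 2 * 0.86)) ^ k := by rw [mul_pow 2]; ring
    _ ≤ _ := by
        refine mul_le_mul_of_nonneg_left ?_ (by norm_num)
        refine pow_le_pow_left₀ (by norm_num) (by norm_num) k

theorem H0_bound (h : Hyp p q lam U) : ‖Hk p q lam U 0‖ ≤ 1 := by
  rw [Hk, Finset.powersetCard_zero, Finset.sum_singleton, Finset.prod_empty, one_mul, ell_eq h,
    exp_sum_comm]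
  refine (Finset.norm_prod_le _ _).trans ?_
  refine Finset.prod_le_one (fun j _ => norm_nonneg _) fun j _ => ?_
  have := norm_expR h j 1 zero_le_one
  rwa [one_smul] at this

theorem F_bound (h : Hyp p q lam U) : ‖∏ j, (1 + Rj p q U j)‖ ≤ 1 := by
  refine (Finset.norm_prod_le _ _).trans ?_
  exact Finset.prod_le_one (fun j _ => norm_nonneg _) fun j _ => normF h j

theorem F_expand (h : Hyp p q lam U) :
    ∏ j, (1 + Rj p q U j) = ∑ k ∈ Finset.range (n + 1), Hk p q lam U k := by
  have h1 : ∏ j, (1 + Rj p q U j) = (∏ j, (1 + Vj p q U j)) * NormedSpace.exp (ell lam U) := by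
    rw [ell_eq h, exp_sum_comm, ← Finset.prod_mul_distrib]
    refine Finset.prod_congr rfl fun j _ => ?_
    rw [Vj, add_sub_cancel, mul_assoc, ← exp_add_comm' (Commute.all _ _), neg_add_cancel,
      NormedSpace.exp_zero, mul_one]
  rw [h1, Finset.prod_one_add, Finset.sum_powerset, Finset.sum_mul]
  simp [Hk]

theorem tail_bound (x : ℝ) (hx : 0 ≤ x) (hx1 : x < 1) (H : ℕ → A) (m N : ℕ) (hm : 3 ≤ m)
    (hH : ∀ k, 3 ≤ k → ‖H k‖ ≤ 0.5591 * x ^ k) :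
    ‖∑ k ∈ Finset.Ico m N, H k‖ ≤ 0.5591 * (x ^ m / (1 - x)) := by
  refine (norm_sum_le _ _).trans ?_
  calc _ ≤ ∑ k ∈ Finset.Ico m N, 0.5591 * x ^ k :=
        Finset.sum_le_sum fun k hk => hH k (hm.trans (Finset.mem_Ico.1 hk).1)
    _ = 0.5591 * ∑ k ∈ Finset.Ico m N, x ^ k := by rw [Finset.mul_sum]
    _ ≤ _ := mul_le_mul_of_nonneg_left (geom_sum_Ico_le_of_lt_one hx hx1) (by norm_num)

theorem tail_num (β b C : ℝ) (m : ℕ) (hβ : 0 ≤ β) (hb : β ≤ b) (hb1 : 4.355 * b < 1)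
    (hC : 0.5591 * 4.355 ^ m ≤ C * (1 - 4.355 * b)) :
    0.5591 * ((4.355 * β) ^ m / (1 - 4.355 * β)) ≤ C * β ^ m := by
  have h0 : 0 < 1 - 4.355 * β := by linarith
  have hC0 : 0 ≤ C := by
    by_contra hc
    push Not at hc
    have : 0 < 0.5591 * (4.355 : ℝ) ^ m := by positivity
    nlinarith
  rw [← mul_div_assoc, div_le_iff₀ h0, mul_pow, ← mul_assoc]
  have : C * β ^ m * (1 - 4.355 * β) = C * (1 - 4.355 * β) * β ^ m := by ring
  rw [this]
  refine mul_le_mul_of_nonneg_right (hC.trans ?_) (by positivity)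
  gcongr

theorem final_num (β : ℝ) (hβ : 0 ≤ β) (H : ℕ → A) (F : A) (n : ℕ)
    (hF : F = ∑ k ∈ Finset.range (n + 1), H k) (hF1 : ‖F‖ ≤ 1)
    (h0 : ‖H 0‖ ≤ 1) (h1 : ‖H 1‖ ≤ 4.84 * β) (h2 : ‖H 2‖ ≤ 16.15 * β ^ 2)
    (h3 : ∀ k, 3 ≤ k → ‖H k‖ ≤ 0.5591 * (4.355 * β) ^ k) (ℓ : ℕ) (hℓn : ℓ ≤ n) (hℓ4 : ℓ ≤ 4) :
    ‖F - ∑ k ∈ Finset.range (ℓ + 1), H k‖ ≤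
      (if ℓ = 0 then 15.6 else if ℓ = 1 then 113.0 else if ℓ = 2 then 633.8
        else if ℓ = 3 then 3204.8 else (15945.6 : ℝ)) * β ^ (ℓ + 1) := by
  have hI : F - ∑ k ∈ Finset.range (ℓ + 1), H k = ∑ k ∈ Finset.Ico (ℓ + 1) (n + 1), H k := by
    rw [hF, Finset.sum_Ico_eq_sub _ (by omega)]
  have hbig : ‖F - ∑ k ∈ Finset.range (ℓ + 1), H k‖ ≤ 1 + ∑ k ∈ Finset.range (ℓ + 1), ‖H k‖ :=
    (norm_sub_le _ _).trans (add_le_add hF1 (norm_sum_le _ _))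
  have tb : ∀ (b C : ℝ) (m : ℕ), 3 ≤ m → β ≤ b → 4.355 * b < 1 →
      0.5591 * 4.355 ^ m ≤ C * (1 - 4.355 * b) →
      ‖∑ k ∈ Finset.Ico m (n + 1), H k‖ ≤ C * β ^ m := fun b C m hm hb hb1 hC =>
    (tail_bound (4.355 * β) (by positivity) (by linarith) H m (n + 1) hm h3).trans
      (tail_num β b C m hβ hb hb1 hC)
  have h33 := h3 3 le_rfl
  have h34 := h3 4 (by norm_num)
  have step1 : ∀ m, m < 3 → ‖∑ k ∈ Finset.Ico m (n + 1), H k‖ ≤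
      ‖H m‖ + ‖∑ k ∈ Finset.Ico (m + 1) (n + 1), H k‖ := by
    intro m _
    rcases Nat.lt_or_ge m (n + 1) with hm | hm
    · rw [Finset.sum_eq_sum_Ico_succ_bot hm]; exact norm_add_le _ _
    · rw [Finset.Ico_eq_empty (by omega), Finset.sum_empty, norm_zero]; positivity
  interval_cases ℓ
  · rcases le_total β 0.1283 with hb | hb
    · rw [hI]
      have t := tb 0.1283 105 3 le_rfl hb (by norm_num) (by norm_num)
      have s1 := step1 1 (by norm_num)
      have s2 := step1 2 (by norm_num)
      norm_num at *
      have e2 : β ^ 2 ≤ 0.1283 * β := by nlinarith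
      have e3 : β ^ 3 ≤ 0.1283 * (0.1283 * β) := by nlinarith
      linarith
    · refine hbig.trans ?_
      norm_num [Finset.sum_range_succ] at *
      linarith
  · rcases le_total β 0.16 with hb | hb
    · rw [hI]
      have t := tb 0.16 160 3 le_rfl hb (by norm_num) (by norm_num)
      have s2 := step1 2 (by norm_num)
      have e3 : β ^ 3 ≤ 0.16 * β ^ 2 := by
        calc β ^ 3 = β * β ^ 2 := by ring
          _ ≤ _ := by gcongr
      norm_num at *
      linarith [sq_nonneg β]
    · refine hbig.trans ?_
      norm_num [Finset.sum_range_succ] at *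
      nlinarith
  · rcases le_total β 0.18 with hb | hb
    · rw [hI]
      have t := tb 0.18 633.8 3 le_rfl hb (by norm_num) (by norm_num)
      simpa using t
    · refine hbig.trans ?_
      have e3 : (0.18 : ℝ) ^ 3 ≤ β ^ 3 := by gcongr
      have e1 : 0.18 ^ 2 * β ≤ β ^ 3 := by
        calc _ ≤ β ^ 2 * β := by gcongr
          _ = _ := by ring
      have e2 : 0.18 * β ^ 2 ≤ β ^ 3 := by
        calc _ ≤ β * β ^ 2 := by gcongr
          _ = _ := by ring
      norm_num [Finset.sum_range_succ] at *
      linarith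
  · rcases le_total β 0.19 with hb | hb
    · rw [hI]
      have t := tb 0.19 3204.8 4 (by norm_num) hb (by norm_num) (by norm_num)
      simpa using t
    · refine hbig.trans ?_
      have e0 : (0.19 : ℝ) ^ 4 ≤ β ^ 4 := by gcongr
      have e1 : 0.19 ^ 3 * β ≤ β ^ 4 := by
        have : (0.19 : ℝ) ^ 3 ≤ β ^ 3 := by gcongr
        calc _ ≤ β ^ 3 * β := by gcongr
          _ = _ := by ring
      have e2 : 0.19 ^ 2 * β ^ 2 ≤ β ^ 4 := by
        calc _ ≤ β ^ 2 * β ^ 2 := by gcongr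
          _ = _ := by ring
      have e3 : 0.19 * β ^ 3 ≤ β ^ 4 := by
        calc _ ≤ β * β ^ 3 := by gcongr
          _ = _ := by ring
      rw [mul_pow] at h33
      norm_num [Finset.sum_range_succ] at *
      linarith
  · rcases le_total β 0.195 with hb | hb
    · rw [hI]
      have t := tb 0.195 15945.6 5 (by norm_num) hb (by norm_num) (by norm_num)
      simpa using t
    · refine hbig.trans ?_
      have e0 : (0.195 : ℝ) ^ 5 ≤ β ^ 5 := by gcongr
      have e1 : 0.195 ^ 4 * β ≤ β ^ 5 := by
        calc _ ≤ β ^ 4 * β := by gcongr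
          _ = _ := by ring
      have e2 : 0.195 ^ 3 * β ^ 2 ≤ β ^ 5 := by
        calc _ ≤ β ^ 3 * β ^ 2 := by gcongr
          _ = _ := by ring
      have e3 : 0.195 ^ 2 * β ^ 3 ≤ β ^ 5 := by
        calc _ ≤ β ^ 2 * β ^ 3 := by gcongr
          _ = _ := by ring
      have e4 : 0.195 * β ^ 4 ≤ β ^ 5 := by
        calc _ ≤ β * β ^ 4 := by gcongr
          _ = _ := by ring
      rw [mul_pow] at h33 h34
      norm_num [Finset.sum_range_succ] at *
      linarith

theorem abstract_main (h : Hyp p q lam U) (ℓ : ℕ) (hℓn : ℓ ≤ n) (hℓ4 : ℓ ≤ 4) :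
    ‖∏ j, (1 + Rj p q U j) - ∑ k ∈ Finset.range (ℓ + 1), Hk p q lam U k‖ ≤
      (if ℓ = 0 then 15.6 else if ℓ = 1 then 113.0 else if ℓ = 2 then 633.8
        else if ℓ = 3 then 3204.8 else (15945.6 : ℝ)) *
        (∑ j, p j ^ 2 * betaj q lam j) ^ (ℓ + 1) :=
  final_num _ (betaTot_nonneg h) (fun k => Hk p q lam U k) _ n (F_expand h) (F_bound h)
    (H0_bound h) (H1_bound h) (H2_bound h) (fun k hk => H3_bound h k hk) ℓ hℓn hℓ4

end PartB3


section PartC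

variable {X : Type*} [AddCommMonoid X]

/-- pairing of a bounded function with a summable one -/
def pair (φ f : X → ℝ) : ℝ := ∑' x, φ x * f x

theorem summ_mul {Y : Type*} {φ f : Y → ℝ} {C : ℝ} (hφ : ∀ x, |φ x| ≤ C) (hf : Summable f) :
    Summable (fun x => φ x * f x) := by
  refine Summable.of_norm_bounded (hf.abs.mul_left C) fun x => ?_
  rw [Real.norm_eq_abs, abs_mul]
  exact mul_le_mul_of_nonneg_right (hφ x) (abs_nonneg _)

theorem pair_abs_le {φ f : X → ℝ} {C : ℝ} (hφ : ∀ x, |φ x| ≤ C) (hf : Summable f) :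
    |pair φ f| ≤ C * l1norm f := by
  rw [← Real.norm_eq_abs]
  refine tsum_of_norm_bounded (hf.abs.hasSum.mul_left C) fun x => ?_
  rw [Real.norm_eq_abs, abs_mul]
  exact mul_le_mul_of_nonneg_right (hφ x) (abs_nonneg _)

theorem summ_prod {f g : X → ℝ} (hf : Summable f) (hg : Summable g) :
    Summable (fun p : X × X => f p.1 * g p.2) :=
  summable_mul_of_summable_norm hf.norm hg.norm

theorem conv_hasSum {φ f g : X → ℝ} {C : ℝ} (hφ : ∀ x, |φ x| ≤ C) (hf : Summable f)
    (hg : Summable g) :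
    HasSum (fun x => φ x * conv f g x) (∑' p : X × X, φ (p.1 + p.2) * (f p.1 * g p.2)) := by
  have hs : Summable (fun p : X × X => φ (p.1 + p.2) * (f p.1 * g p.2)) :=
    summ_mul (fun p => hφ _) (summ_prod hf hg)
  have h1 := (Equiv.sigmaFiberEquiv (fun p : X × X => p.1 + p.2)).hasSum_iff.2 hs.hasSum
  refine h1.sigma fun x => ?_
  have h2 : Summable (fun p : {p : X × X // p.1 + p.2 = x} => f p.1.1 * g p.1.2) :=
    (summ_prod hf hg).subtype {p : X × X | p.1 + p.2 = x}
  have h3 := h2.hasSum.mul_left (φ x)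
  refine Eq.mp (congrArg (fun F => HasSum F _) (funext fun p => ?_)) h3
  obtain ⟨p, rfl⟩ := p
  rfl

theorem conv_summable {f g : X → ℝ} (hf : Summable f) (hg : Summable g) :
    Summable (conv f g) := by
  have := (conv_hasSum (φ := fun _ => 1) (C := 1) (by simp) hf hg).summable
  simpa using this

theorem pair_conv {φ f g : X → ℝ} {C : ℝ} (hφ : ∀ x, |φ x| ≤ C) (hf : Summable f)
    (hg : Summable g) :
    pair φ (conv f g) = pair (fun y => pair (fun z => φ (y + z)) g) f := by
  have hs : Summable (fun p : X × X => φ (p.1 + p.2) * (f p.1 * g p.2)) :=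
    summ_mul (fun p => hφ _) (summ_prod hf hg)
  rw [pair, (conv_hasSum hφ hf hg).tsum_eq, hs.tsum_prod, pair]
  refine tsum_congr fun y => ?_
  rw [pair, ← tsum_mul_right]
  refine tsum_congr fun z => ?_
  ring

theorem ext_pair {f g : X → ℝ} (h : ∀ φ : X → ℝ, (∀ x, |φ x| ≤ 1) → pair φ f = pair φ g) :
    f = g := by
  funext x
  have := h (fun y => if y = x then 1 else 0) (fun y => by split_ifs <;> simp)
  simpa [pair] using this

theorem pair_add {φ f g : X → ℝ} {C : ℝ} (hφ : ∀ x, |φ x| ≤ C) (hf : Summable f)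
    (hg : Summable g) : pair φ (f + g) = pair φ f + pair φ g := by
  rw [pair, pair, pair, ← (summ_mul hφ hf).tsum_add (summ_mul hφ hg)]
  refine tsum_congr fun x => ?_
  simp [mul_add]

theorem pair_smul {φ f : X → ℝ} (c : ℝ) : pair φ (c • f) = c * pair φ f := by
  rw [pair, pair, ← tsum_mul_left]
  refine tsum_congr fun x => ?_
  simp; ring

theorem delta_summable (x : X) : Summable (delta x) := by
  apply summable_of_ne_finset_zero (s := {x})
  intro b hb
  simp at hb
  simp [delta, hb]

theorem pair_delta (φ : X → ℝ) (x : X) : pair φ (delta x) = φ x := by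
  simp [pair, delta]

theorem shift_bd {φ g : X → ℝ} {C : ℝ} (hφ : ∀ x, |φ x| ≤ C) (hg : Summable g) (y : X) :
    |pair (fun z => φ (y + z)) g| ≤ C * l1norm g :=
  pair_abs_le (fun z => hφ (y + z)) hg

theorem conv_comm (f g : X → ℝ) : conv f g = conv g f := by
  funext x
  let e : {p : X × X // p.1 + p.2 = x} ≃ {p : X × X // p.1 + p.2 = x} :=
    (Equiv.prodComm X X).subtypeEquiv (fun p => by simp [add_comm])
  rw [conv, conv, ← e.tsum_eq]
  refine tsum_congr fun p => ?_
  simp [e, mul_comm]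

theorem conv_assoc {f g h : X → ℝ} (hf : Summable f) (hg : Summable g) (hh : Summable h) :
    conv (conv f g) h = conv f (conv g h) := by
  refine ext_pair fun φ hφ => ?_
  rw [pair_conv hφ (conv_summable hf hg) hh, pair_conv (shift_bd hφ hh) hf hg,
    pair_conv hφ hf (conv_summable hg hh)]
  congr 1
  funext u
  rw [pair_conv (fun x => hφ (u + x)) hg hh]
  simp only [add_assoc]

theorem conv_add {f g h : X → ℝ} (hf : Summable f) (hg : Summable g) (hh : Summable h) :
    conv (f + g) h = conv f h + conv g h := by
  refine ext_pair fun φ hφ => ?_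
  have hfg : Summable (f + g) := hf.add hg
  rw [pair_conv hφ hfg hh, pair_add hφ (conv_summable hf hh) (conv_summable hg hh),
    pair_add (shift_bd hφ hh) hf hg, pair_conv hφ hf hh, pair_conv hφ hg hh]

theorem conv_smul {f h : X → ℝ} (c : ℝ) (hf : Summable f) (hh : Summable h) :
    conv (c • f) h = c • conv f h := by
  refine ext_pair fun φ hφ => ?_
  have hcf : Summable (c • f) := hf.const_smul c
  rw [pair_conv hφ hcf hh, pair_smul, pair_smul, pair_conv hφ hf hh]

theorem delta_conv {f : X → ℝ} (hf : Summable f) : conv (delta 0) f = f := by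
  refine ext_pair fun φ hφ => ?_
  rw [pair_conv hφ (delta_summable 0) hf, pair_delta]
  simp

theorem l1norm_conv_le {f g : X → ℝ} (hf : Summable f) (hg : Summable g) :
    l1norm (conv f g) ≤ l1norm f * l1norm g := by
  set s : X → ℝ := fun x => if 0 ≤ conv f g x then 1 else -1 with hs
  have hs1 : ∀ x, |s x| ≤ 1 := by intro x; simp only [hs]; split_ifs <;> simp
  have h1 : l1norm (conv f g) = pair s (conv f g) := by
    refine tsum_congr fun x => ?_
    simp only [hs]; split_ifs with h
    · rw [abs_of_nonneg h, one_mul]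
    · rw [abs_of_neg (not_le.1 h)]; ring
  rw [h1, pair_conv hs1 hf hg, mul_comm]
  refine (le_abs_self _).trans (pair_abs_le (fun y => ?_) hf)
  simpa using shift_bd hs1 hg y

theorem l1norm_delta : l1norm (delta (0 : X)) = 1 := by
  rw [l1norm, tsum_eq_single (0 : X)]
  · simp [delta]
  · intro b hb; simp [delta, hb]

/-- The Banach algebra of absolutely summable functions. -/
def L1 (X : Type*) : Type _ := lp (fun _ : X => ℝ) 1

instance : NormedAddCommGroup (L1 X) := inferInstanceAs (NormedAddCommGroup (lp (fun _ : X => ℝ) 1))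
instance : NormedSpace ℝ (L1 X) := inferInstanceAs (NormedSpace ℝ (lp (fun _ : X => ℝ) 1))
instance : CompleteSpace (L1 X) := inferInstanceAs (CompleteSpace (lp (fun _ : X => ℝ) 1))

/-- underlying function, as a linear map -/
def fn : L1 X →ₗ[ℝ] (X → ℝ) where
  toFun f := (show lp (fun _ : X => ℝ) 1 from f).1
  map_add' _ _ := rfl
  map_smul' _ _ := rfl

theorem fn_inj {f g : L1 X} (h : fn f = fn g) : f = g := Subtype.ext h

theorem fn_summable (f : L1 X) : Summable (fn f) := by
  have h := (show lp (fun _ : X => ℝ) 1 from f).2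
  have h2 := (memℓp_gen_iff (p := 1) (by simp)).1 h
  simp only [ENNReal.toReal_one, Real.rpow_one] at h2
  exact h2.of_norm

def mkL (f : X → ℝ) (hf : Summable f) : L1 X :=
  (⟨f, by
    refine memℓp_gen (p := 1) ?_
    simpa using hf.abs⟩ : lp (fun _ : X => ℝ) 1)

theorem fn_mkL (f : X → ℝ) (hf : Summable f) : fn (mkL f hf) = f := rfl

theorem norm_fn (f : L1 X) : ‖f‖ = l1norm (fn f) := by
  have := lp.norm_eq_tsum_rpow (p := 1) (by simp) (show lp (fun _ : X => ℝ) 1 from f)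
  simp only [ENNReal.toReal_one, Real.rpow_one, div_one] at this
  exact this

instance : Mul (L1 X) := ⟨fun f g => mkL (conv (fn f) (fn g)) (conv_summable (fn_summable f) (fn_summable g))⟩
instance : One (L1 X) := ⟨mkL (delta 0) (delta_summable 0)⟩

theorem fn_mul (f g : L1 X) : fn (f * g) = conv (fn f) (fn g) := rfl
theorem fn_one : fn (1 : L1 X) = delta 0 := rfl

theorem L1_mul_comm (f g : L1 X) : f * g = g * f := fn_inj (by rw [fn_mul, fn_mul, conv_comm])
theorem L1_add_mul (f g h : L1 X) : (f + g) * h = f * h + g * h := fn_inj (by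
  rw [fn_mul, map_add, map_add, conv_add (fn_summable f) (fn_summable g) (fn_summable h), fn_mul,
    fn_mul])
theorem L1_one_mul (f : L1 X) : 1 * f = f := fn_inj (by
  rw [fn_mul, fn_one, delta_conv (fn_summable f)])
theorem L1_zero_mul (f : L1 X) : 0 * f = 0 := by
  have := L1_add_mul 0 0 f
  rw [add_zero] at this
  simpa using this

instance : NormedCommRing (L1 X) :=
  { (inferInstance : NormedAddCommGroup (L1 X)) with
    mul_assoc := fun f g h => fn_inj (by
      simp only [fn_mul]
      exact conv_assoc (fn_summable f) (fn_summable g) (fn_summable h))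
    mul_comm := L1_mul_comm
    one_mul := L1_one_mul
    mul_one := fun f => by rw [L1_mul_comm, L1_one_mul]
    zero_mul := L1_zero_mul
    mul_zero := fun f => by rw [L1_mul_comm, L1_zero_mul]
    right_distrib := L1_add_mul
    left_distrib := fun f g h => by
      rw [L1_mul_comm, L1_add_mul, L1_mul_comm g, L1_mul_comm h]
    norm_mul_le := fun f g => by
      rw [norm_fn, norm_fn, norm_fn, fn_mul]
      exact l1norm_conv_le (fn_summable f) (fn_summable g) }

instance : NormOneClass (L1 X) := ⟨by rw [norm_fn, fn_one, l1norm_delta]⟩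

theorem L1_smul_mul (c : ℝ) (f g : L1 X) : (c • f) * g = c • (f * g) := fn_inj (by
  rw [fn_mul, map_smul, map_smul, fn_mul, conv_smul c (fn_summable f) (fn_summable g)])

instance : Algebra ℝ (L1 X) :=
  Algebra.ofModule L1_smul_mul (fun c f g => by
    rw [mul_comm, L1_smul_mul, mul_comm])

instance : NormedAlgebra ℝ (L1 X) :=
  { (inferInstance : Algebra ℝ (L1 X)) with
    norm_smul_le := fun c f => (norm_smul c f).le }

def evL (x : X) : L1 X →L[ℝ] ℝ :=
  LinearMap.mkContinuous
    { toFun := fun f => fn f x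
      map_add' := fun f g => by simp
      map_smul' := fun c f => by simp } 1 (fun f => by
    rw [norm_fn, one_mul]
    exact (fn_summable f).abs.le_tsum x (fun y _ => abs_nonneg _))

theorem convPow_fn (f : L1 X) (m : ℕ) : convPow (fn f) m = fn (f ^ m) := by
  induction m with
  | zero => rw [pow_zero, fn_one]; rfl
  | succ m ih => rw [convPow, ih, pow_succ', fn_mul]

theorem convExp_fn (f : L1 X) : convExp (fn f) = fn (NormedSpace.exp f) := by
  funext x
  have h := (NormedSpace.exp_series_hasSum_exp' (𝕂 := ℝ) f).mapL (evL x)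
  have h2 : evL x (NormedSpace.exp f) = fn (NormedSpace.exp f) x := rfl
  rw [← h2, ← h.tsum_eq, convExp]
  refine tsum_congr fun m => ?_
  rw [convPow_fn, map_smul, smul_eq_mul]; rfl

theorem convProd_fn {ι : Type*} [LinearOrder ι] (s : Finset ι) (g : ι → L1 X) :
    convProd s (fun i => fn (g i)) = fn (∏ i ∈ s, g i) := by
  have h1 : ∀ l : List ι, l.foldr (fun i acc => conv (fn (g i)) acc) (delta 0) =
      fn (l.map g).prod := by
    intro l
    induction l with
    | nil => simp [fn_one]
    | cons a l ih => rw [List.foldr_cons, ih, List.map_cons, List.prod_cons, fn_mul]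
  rw [convProd, h1, Finset.prod, ← Finset.sort_eq s (· ≤ ·), Multiset.map_coe, Multiset.prod_coe]

end PartC

end CPB

/-- Theorem 3 of Roos: without any restrictions,
`‖F - G_ℓ‖ ≤ c_ℓ β₁^{ℓ+1}` for `ℓ ∈ {0,…,4}`, with
`c₀ = 15.6, c₁ = 113.0, c₂ = 633.8, c₃ = 3204.8, c₄ = 15945.6`. -/
theorem compound_poisson_higher_order_beta_bound
    {X : Type*} [AddCommMonoid X] [Countable X]
    (d n : ℕ) (hd : 1 ≤ d) (hn : 1 ≤ n)
    (p : Fin n → ℝ) (q : Fin n → Fin d → ℝ)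
    (hp : ∀ j, p j ∈ Set.Icc (0:ℝ) 1)
    (hq : ∀ j r, q j r ∈ Set.Icc (0:ℝ) 1)
    (hq1 : ∀ j, ∑ r, q j r = 1)
    (lam : Fin d → ℝ) (hlam : ∀ r, lam r = ∑ j, p j * q j r)
    (hlampos : ∀ r, 0 < lam r)
    (U : Fin d → X → ℝ) (hU : ∀ r, IsPmf (U r))
    (Q : Fin n → X → ℝ) (hQ : ∀ j, Q j = ∑ r, q j r • U r)
    (lamtot : ℝ) (hlamtot : lamtot = ∑ j, p j)
    (Qbar : X → ℝ) (hQbar : Qbar = lamtot⁻¹ • ∑ j, p j • Q j)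
    (R : Fin n → X → ℝ) (hR : ∀ j, R j = p j • (Q j - delta 0))
    (Fj : Fin n → X → ℝ) (hFj : ∀ j, Fj j = delta 0 + R j)
    (V : Fin n → X → ℝ) (hV : ∀ j, V j = conv (Fj j) (convExp (-(R j))) - delta 0)
    (F : X → ℝ) (hF : F = convProd Finset.univ Fj)
    (M : ℕ → X → ℝ)
    (hM : ∀ k, M k = ∑ J ∈ Finset.powersetCard k Finset.univ, convProd J V)
    (H : ℕ → X → ℝ)
    (hH : ∀ k, H k = conv (M k) (convExp (lamtot • (Qbar - delta 0))))
    (ℓ : ℕ) (hℓn : ℓ ≤ n) (hℓ4 : ℓ ≤ 4)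
    (Gl : X → ℝ) (hGl : Gl = ∑ k ∈ Finset.range (ℓ + 1), H k)
    (β₁ : ℝ)
    (hβ₁ : β₁ = ∑ j, (p j) ^ 2 * ∑ r, q j r * min (q j r / lam r) 1) :
    l1norm (F - Gl) ≤
      (if ℓ = 0 then 15.6 else if ℓ = 1 then 113.0 else if ℓ = 2 then 633.8
        else if ℓ = 3 then 3204.8 else (15945.6 : ℝ)) * β₁ ^ (ℓ + 1) := by
  have hUs : ∀ r, Summable (U r) := fun r => (hU r).2.summable
  set UU : Fin d → CPB.L1 X := fun r => CPB.mkL (U r) (hUs r) with hUU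
  have fU : ∀ r, U r = CPB.fn (UU r) := fun r => rfl
  have hyp : CPB.Hyp p q lam UU :=
    { hp := hp
      hq := hq
      hq1 := hq1
      hlam := hlam
      hpos := hlampos
      hU := fun r => by
        rw [CPB.norm_fn, ← fU]
        have h1 : l1norm (U r) = 1 := by
          rw [← (hU r).2.tsum_eq]
          exact tsum_congr fun x => abs_of_nonneg ((hU r).1 x)
        exact h1.le }
  have fQ : ∀ j, Q j = CPB.fn (∑ r, q j r • UU r) := by
    intro j
    rw [hQ, map_sum]
    refine Finset.sum_congr rfl fun r _ => ?_
    rw [map_smul, fU]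
  have fR : ∀ j, R j = CPB.fn (CPB.Rj p q UU j) := by
    intro j
    rw [hR, fQ, CPB.Rj, map_smul, map_sub, CPB.fn_one]
  have fF : Fj = fun j => CPB.fn (1 + CPB.Rj p q UU j) := by
    funext j
    rw [hFj, fR, map_add, CPB.fn_one]
  have fV : V = fun j => CPB.fn (CPB.Vj p q UU j) := by
    funext j
    rw [hV, fF, fR, ← map_neg, CPB.convExp_fn, ← CPB.fn_mul, ← CPB.fn_one, ← map_sub, CPB.Vj]
  have fFF : F = CPB.fn (∏ j, (1 + CPB.Rj p q UU j)) := by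
    rw [hF, fF, CPB.convProd_fn]
  have fM : ∀ k, M k = CPB.fn (∑ J ∈ Finset.powersetCard k Finset.univ, ∏ j ∈ J, CPB.Vj p q UU j) := by
    intro k
    rw [hM, map_sum, fV]
    exact Finset.sum_congr rfl fun J _ => CPB.convProd_fn J _
  have hlt : lamtot = ∑ r, lam r := by
    simp only [hlam]
    rw [Finset.sum_comm, hlamtot]
    refine Finset.sum_congr rfl fun j _ => ?_
    rw [← Finset.mul_sum, hq1, mul_one]
  have hlt0 : lamtot ≠ 0 := by
    have : Nonempty (Fin d) := ⟨⟨0, hd⟩⟩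
    rw [hlt]
    exact (Finset.sum_pos (fun r _ => hlampos r) Finset.univ_nonempty).ne'
  have fE : lamtot • (Qbar - delta 0) = CPB.fn (CPB.ell lam UU) := by
    rw [CPB.ell_eq hyp, map_sum, hQbar, smul_sub, smul_smul, mul_inv_cancel₀ hlt0, one_smul]
    nth_rewrite 1 [hlamtot]
    rw [Finset.sum_smul, ← Finset.sum_sub_distrib]
    refine Finset.sum_congr rfl fun j _ => ?_
    rw [← fR, hR, smul_sub]
  have fH : ∀ k, H k = CPB.fn (CPB.Hk p q lam UU k) := by
    intro k
    rw [hH, fM, fE, CPB.convExp_fn, ← CPB.fn_mul, CPB.Hk]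
  have fG : Gl = CPB.fn (∑ k ∈ Finset.range (ℓ + 1), CPB.Hk p q lam UU k) := by
    rw [hGl, map_sum]
    exact Finset.sum_congr rfl fun k _ => fH k
  rw [fFF, fG, ← map_sub, ← CPB.norm_fn, hβ₁]
  exact CPB.abstract_main hyp ℓ hℓn hℓ4
end
end
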